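/- Let i ∈ [N] be a half-integer not in ℤ with i ≤ N/2, and write i = k + 1/2 with k a nonnegative integer. Then the dimension of the eigenspace of A for the eigenvalue θ_i equals ∑_{ℓ=0}^{k} μ_{2ℓ+1} · binom(N−2ℓ−1, k−ℓ)_q. -/

import Mathlib

open Module Matrix Finset

noncomputable section

open scoped Classical

variable {F H : Type} [Field F] [Fintype F] [AddCommGroup H] [Module F H]
  [FiniteDimensional F H]

/-- The vertex set of the Attenuated Space poset `A_q(N,M)`:
the subspaces of `H` that intersect `h` trivially. -/
def AttX (h : Submodule F H) := {y : Submodule F H // y ⊓ h = ⊥}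

instance (h : Submodule F H) : Fintype (AttX h) := by
  have : Finite H := Module.finite_of_finite F
  have : Finite (Submodule F H) :=
    Finite.of_injective (fun y : Submodule F H => (y : Set H)) SetLike.coe_injective
  have : Finite (AttX h) := Subtype.finite
  exact Fintype.ofFinite _

/-- The dimension of a vertex. -/
def vdim (h : Submodule F H) (y : AttX h) : ℕ := finrank F (y.1 : Submodule F H)

/-- `AttCovers h y z` means that `z` covers `y`: `y ⊆ z` and `dim z = dim y + 1`. -/
def AttCovers (h : Submodule F H) (y z : AttX h) : Prop :=
  y.1 ≤ z.1 ∧ vdim h z = vdim h y + 1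

/-- The `q`-integer `[n]_q = (q^n - 1)/(q - 1)`. -/
def qInt (q n : ℕ) : ℕ := (q ^ n - 1) / (q - 1)

/-- The `q`-factorial `[n]_q!`. -/
def qFact (q : ℕ) : ℕ → ℕ
  | 0 => 1
  | n + 1 => qInt q (n + 1) * qFact q n

/-- The Gaussian binomial coefficient `binom(n,i)_q`. -/
def qBinom (q n i : ℕ) : ℕ := qFact q n / (qFact q i * qFact q (n - i))

/-- The raising matrix `R`: `(y,z)`-entry `1` if `y` covers `z`, else `0`. -/
def Rmat (h : Submodule F H) : Matrix (AttX h) (AttX h) ℂ :=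
  fun y z => if AttCovers h z y then 1 else 0

/-- The lowering matrix `L'`: `(y,z)`-entry `1` if `z` covers `y`, else `0`. -/
def Lpmat (h : Submodule F H) : Matrix (AttX h) (AttX h) ℂ :=
  fun y z => if AttCovers h y z then 1 else 0

/-- The `q`-lowering matrix `L`: `(y,z)`-entry `q^(dim y)` if `z` covers `y`, else `0`. -/
def Lmat (h : Submodule F H) (q : ℕ) : Matrix (AttX h) (AttX h) ℂ :=
  fun y z => if AttCovers h y z then (q : ℂ) ^ (vdim h y) else 0

/-- The `q`-adjacency matrix `A`: `(y,z)`-entry `1` if `y` covers `z`,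
`q^(dim y)` if `z` covers `y`, and `0` otherwise. -/
def Amat (h : Submodule F H) (q : ℕ) : Matrix (AttX h) (AttX h) ℂ :=
  fun y z =>
    if AttCovers h z y then 1 else if AttCovers h y z then (q : ℂ) ^ (vdim h y) else 0

/-- The dual adjacency matrix `A*`: diagonal with `(y,y)`-entry `q^{-dim y}`. -/
def Astar (h : Submodule F H) (q : ℕ) : Matrix (AttX h) (AttX h) ℂ :=
  Matrix.diagonal fun y => (q : ℂ) ^ (-(vdim h y : ℤ))

/-- The matrix `S`: diagonal with `(y,y)`-entry `(-1)^(dim y)`. -/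
def Smat (h : Submodule F H) : Matrix (AttX h) (AttX h) ℂ :=
  Matrix.diagonal fun y => (-1 : ℂ) ^ (vdim h y)

/-- The matrix `E*_i`: diagonal with `(y,y)`-entry `1` if `dim y = i`, else `0`. -/
def Estar (h : Submodule F H) (i : ℕ) : Matrix (AttX h) (AttX h) ℂ :=
  Matrix.diagonal fun y => if vdim h y = i then (1 : ℂ) else 0

/-- The eigenvalue `θ_i` for `i = k/2 ∈ [N] = {0, 1/2, 1, …, N}` (so `k = 0,…,2N`):
`θ_i = (q^(N-i) - q^i)/(q - 1) · q^(M/2)`, written via `√q`. -/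
def theta (q N M k : ℕ) : ℝ :=
  (Real.sqrt q ^ (2 * N - k) - Real.sqrt q ^ k) / ((q : ℝ) - 1) * Real.sqrt q ^ M

/-- The eigenspace of the `q`-adjacency matrix `A` for the eigenvalue `θ_{k/2}`. -/
def eigA (h : Submodule F H) (q N M k : ℕ) : Submodule ℂ (AttX h → ℂ) :=
  Module.End.eigenspace (Matrix.toLin' (Amat h q)) ((theta q N M k : ℝ) : ℂ)

/-- The multiplicity scalar `μ_r = binom(N,r)_q binom(M,r)_q (q^r-1)(q^r-q)⋯(q^r-q^(r-1))`. -/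
def muMult (q N M r : ℕ) : ℕ :=
  qBinom q N r * qBinom q M r * ∏ j ∈ Finset.range r, (q ^ r - q ^ j)

section Multiplicity

variable {P P' : Type} [Fintype P] [Fintype P']

/-- The geometric multiplicity of `θ` as an eigenvalue of the matrix `A`. -/
def eigMult (A : Matrix P P ℂ) (θ : ℂ) : ℕ :=
  finrank ℂ (Module.End.eigenspace A.mulVecLin θ)

lemma mem_eigenspace_mulVecLin (A : Matrix P P ℂ) (θ : ℂ) (v : P → ℂ) :
    v ∈ Module.End.eigenspace A.mulVecLin θ ↔ A *ᵥ v = θ • v := by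
  rw [Module.End.mem_eigenspace_iff, Matrix.mulVecLin_apply]

lemma eigMult_eq_of_intertwine [DecidableEq P] [DecidableEq P'] {A : Matrix P P ℂ}
    {B : Matrix P' P' ℂ} (S : Matrix P P' ℂ) (S' : Matrix P' P ℂ)
    (h₁ : S * S' = 1) (h₂ : S' * S = 1) (h : A * S = S * B) (θ : ℂ) :
    eigMult A θ = eigMult B θ := by
  have h' : S' * A = B * S' := by
    calc S' * A = S' * A * (S * S') := by rw [h₁, Matrix.mul_one]
      _ = S' * (A * S) * S' := by simp only [Matrix.mul_assoc]
      _ = (S' * S) * B * S' := by rw [h]; simp only [Matrix.mul_assoc]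
      _ = B * S' := by rw [h₂, Matrix.one_mul]
  symm
  refine LinearEquiv.finrank_eq
    { toFun := fun v => ⟨S *ᵥ v.1, ?_⟩
      invFun := fun v => ⟨S' *ᵥ v.1, ?_⟩
      map_add' := fun v w => Subtype.ext (by simp [Matrix.mulVec_add])
      map_smul' := fun c v => Subtype.ext (by simp [Matrix.mulVec_smul])
      left_inv := fun v => Subtype.ext (by simp [h₂])
      right_inv := fun v => Subtype.ext (by simp [h₁]) }
  · have hv := (mem_eigenspace_mulVecLin B θ v.1).1 v.2
    rw [mem_eigenspace_mulVecLin, Matrix.mulVec_mulVec, h, ← Matrix.mulVec_mulVec, hv,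
      Matrix.mulVec_smul]
  · have hv := (mem_eigenspace_mulVecLin A θ v.1).1 v.2
    rw [mem_eigenspace_mulVecLin, Matrix.mulVec_mulVec, ← h', ← Matrix.mulVec_mulVec, hv,
      Matrix.mulVec_smul]

lemma eigMult_submatrix (A : Matrix P P ℂ) (e : P' ≃ P) (θ : ℂ) :
    eigMult (A.submatrix e e) θ = eigMult A θ := by
  symm
  refine eigMult_eq_of_intertwine ((1 : Matrix P P ℂ).submatrix id e)
    ((1 : Matrix P P ℂ).submatrix e id) ?_ ?_ ?_ θ
  · rw [Matrix.submatrix_mul_equiv]; simp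
  · rw [← Matrix.submatrix_mul _ _ _ _ _ Function.bijective_id]; simp
  · rw [Matrix.submatrix_mul_equiv, Matrix.one_mul]
    have := (Matrix.submatrix_mul A (1 : Matrix P P ℂ) id id e Function.bijective_id).symm
    simpa using this

lemma eigMult_fromBlocks (A : Matrix P P ℂ) (B : Matrix P' P' ℂ) (θ : ℂ) :
    eigMult (fromBlocks A 0 0 B) θ = eigMult A θ + eigMult B θ := by
  unfold eigMult
  rw [← Module.finrank_prod]
  have key : ∀ v : P ⊕ P' → ℂ, v ∈ Module.End.eigenspace (fromBlocks A 0 0 B).mulVecLin θ ↔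
      v ∘ Sum.inl ∈ Module.End.eigenspace A.mulVecLin θ ∧
      v ∘ Sum.inr ∈ Module.End.eigenspace B.mulVecLin θ := by
    intro v
    simp only [mem_eigenspace_mulVecLin, fromBlocks_mulVec]
    constructor
    · intro h
      constructor
      · funext x; simpa using congrFun h (Sum.inl x)
      · funext x; simpa using congrFun h (Sum.inr x)
    · rintro ⟨h1, h2⟩
      funext x
      rcases x with x | x
      · simpa using congrFun h1 x
      · simpa using congrFun h2 x
  exact LinearEquiv.finrank_eq
    { toFun := fun v => (⟨_, ((key v.1).1 v.2).1⟩, ⟨_, ((key v.1).1 v.2).2⟩)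
      invFun := fun v => ⟨Sum.elim v.1.1 v.2.1, (key _).2 ⟨v.1.2, v.2.2⟩⟩
      map_add' := fun v w => rfl
      map_smul' := fun c v => rfl
      left_inv := fun v => Subtype.ext (Sum.elim_comp_inl_inr v.1)
      right_inv := fun v => rfl }

lemma eigMult_blockDiagonal' {I : Type} [Fintype I] {Q : I → Type} [∀ i, Fintype (Q i)]
    (A : ∀ i, Matrix (Q i) (Q i) ℂ) (θ : ℂ) :
    eigMult (blockDiagonal' A) θ = ∑ i, eigMult (A i) θ := by
  unfold eigMult
  rw [← Module.finrank_pi_fintype]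
  have key : ∀ v : (Σ i, Q i) → ℂ, v ∈ Module.End.eigenspace (blockDiagonal' A).mulVecLin θ ↔
      ∀ i, (fun x => v ⟨i, x⟩) ∈ Module.End.eigenspace (A i).mulVecLin θ := by
    intro v
    have hmul : ∀ i x, (blockDiagonal' A *ᵥ v) ⟨i, x⟩ = (A i *ᵥ fun y => v ⟨i, y⟩) x := by
      intro i x
      simp only [mulVec, dotProduct, Fintype.sum_sigma]
      rw [Finset.sum_eq_single i]
      · simp [blockDiagonal'_apply_eq]
      · intro j _ hj
        refine Finset.sum_eq_zero fun y _ => ?_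
        rw [blockDiagonal'_apply_ne _ _ _ hj.symm, zero_mul]
      · simp
    simp only [mem_eigenspace_mulVecLin, funext_iff, Sigma.forall, hmul, Pi.smul_apply]
  exact LinearEquiv.finrank_eq
    { toFun := fun v i => ⟨_, (key v.1).1 v.2 i⟩
      invFun := fun v => ⟨fun x => (v x.1).1 x.2, (key _).2 fun i => (v i).2⟩
      map_add' := fun v w => rfl
      map_smul' := fun c v => rfl
      left_inv := fun v => rfl
      right_inv := fun v => rfl }

end Multiplicity

section WeightedAdjacency

variable {P P' : Type} [Fintype P] [Fintype P'] [DecidableEq P] [DecidableEq P']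

/-- The `(y,z)`-entry is `1` if `y` covers `z` (that is, `c z y`), else `0`. -/
def coverMat (c : P → P → Prop) : Matrix P P ℂ := fun y z => if c z y then 1 else 0

/-- The weighted adjacency matrix of the covering relation `c`, graded by `d`, with weight
`s * q ^ d y` going up and `τ y * q ^ d y` on the diagonal. -/
def wAdj (c : P → P → Prop) (d : P → ℕ) (q s : ℂ) (τ : P → ℂ) : Matrix P P ℂ :=
  coverMat c + diagonal (fun y => s * q ^ d y) * (coverMat c)ᵀ + diagonal (fun y => τ y * q ^ d y)

lemma wAdj_apply (c : P → P → Prop) (d : P → ℕ) (q s : ℂ) (τ : P → ℂ) (y z : P) :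
    wAdj c d q s τ y z = (if c z y then 1 else 0) + (if c y z then s * q ^ d y else 0) +
      (if y = z then τ y * q ^ d y else 0) := by
  simp [wAdj, coverMat, diagonal_mul, diagonal_apply]

lemma wAdj_submatrix {c : P → P → Prop} {d : P → ℕ} {c' : P' → P' → Prop} {d' : P' → ℕ}
    (e : P' ≃ P) (k : ℕ) (hc : ∀ y z, c' y z ↔ c (e y) (e z)) (hd : ∀ y, d (e y) = d' y + k)
    (q s t : ℂ) :
    (wAdj c d q s fun _ => t).submatrix e e =
      wAdj c' d' q (s * q ^ k) fun _ => t * q ^ k := by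
  ext y z
  simp only [submatrix_apply, wAdj_apply, hc, hd, e.injective.eq_iff, pow_add]
  congr 2
  · congr 1; ring
  · ring

lemma eigMult_wAdj_congr {c : P → P → Prop} {d : P → ℕ} {c' : P' → P' → Prop} {d' : P' → ℕ}
    (e : P' ≃ P) (k : ℕ) (hc : ∀ y z, c' y z ↔ c (e y) (e z)) (hd : ∀ y, d (e y) = d' y + k)
    (q s t θ : ℂ) :
    eigMult (wAdj c d q s fun _ => t) θ =
      eigMult (wAdj c' d' q (s * q ^ k) fun _ => t * q ^ k) θ := by
  rw [← wAdj_submatrix e k hc hd, eigMult_submatrix]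

end WeightedAdjacency

section PartialMaps

set_option linter.unusedSectionVars false

variable {W : Type} [AddCommGroup W] [Module F W] [Finite W]
variable {ι : Type} [Fintype ι]

instance instFintypeSubmodule : Fintype (Submodule F W) := Fintype.ofFinite _

instance instFintypeLinearPMap : Fintype (W →ₗ.[F] (ι → F)) :=
  haveI : Finite (W →ₗ.[F] (ι → F)) :=
    Finite.of_injective (fun p => p.graph) fun _ _ h => LinearPMap.eq_of_eq_graph h
  Fintype.ofFinite _

instance instFintypeLinearMap (U : Submodule F W) : Fintype (U →ₗ[F] (ι → F)) :=
  haveI : Finite (U →ₗ[F] (ι → F)) := Module.finite_of_finite F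
  Fintype.ofFinite _

/-- The covering relation of the subspace lattice. -/
def SubCovers (U V : Submodule F W) : Prop := U ≤ V ∧ finrank F V = finrank F U + 1

/-- The covering relation on linear maps defined on subspaces, ordered by extension. -/
def PMapCovers (p p' : W →ₗ.[F] (ι → F)) : Prop :=
  p ≤ p' ∧ finrank F p'.domain = finrank F p.domain + 1

variable (F W ι) in
/-- Families of vectors together with a subspace containing them. -/
abbrev FamilySub : Type := Σ ψ : ι → W, {U : Submodule F W // ∀ i, ψ i ∈ U}

instance instFintypeFamilySub : Fintype (FamilySub F W ι) :=
  Fintype.ofFinite _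

instance instFintypeContaining (ψ : ι → W) : Fintype {U : Submodule F W // ∀ i, ψ i ∈ U} :=
  Fintype.ofFinite _

/-- The covering relation on subspaces containing a fixed family. -/
def FamilyCovers (x y : FamilySub F W ι) : Prop := x.1 = y.1 ∧ SubCovers x.2.1 y.2.1

/-- The pairing of a partially defined map with a family of vectors of its domain. -/
def pmapPairing (p : W →ₗ.[F] (ι → F)) (ψ : ι → W) : F :=
  ∑ i, if h : ψ i ∈ p.domain then p ⟨ψ i, h⟩ i else 0

lemma pmapPairing_eq_of_le {p p' : W →ₗ.[F] (ι → F)} (hp : p ≤ p') {ψ : ι → W}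
    (hψ : ∀ i, ψ i ∈ p.domain) : pmapPairing p' ψ = pmapPairing p ψ := by
  refine Finset.sum_congr rfl fun i _ => ?_
  rw [dif_pos (hψ i), dif_pos (hp.1 (hψ i))]
  exact congrFun (hp.2 (x := ⟨ψ i, hψ i⟩) (y := ⟨ψ i, hp.1 (hψ i)⟩) rfl).symm i

/-- The fibrewise Fourier transform attached to an additive character of the base field. -/
def fourierMat (χ : AddChar F ℂ) : Matrix (W →ₗ.[F] (ι → F)) (FamilySub F W ι) ℂ :=
  fun p x => if p.domain = x.2.1 then χ (pmapPairing p x.1) else 0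

lemma finrank_domRestrict {p : W →ₗ.[F] (ι → F)} {U : Submodule F W} (h : U ≤ p.domain) :
    (p.domRestrict U).domain = U := by
  rw [LinearPMap.domRestrict_domain]; exact inf_eq_left.2 h

lemma coverMat_mul_fourierMat (χ : AddChar F ℂ) :
    (coverMat PMapCovers : Matrix (W →ₗ.[F] (ι → F)) (W →ₗ.[F] (ι → F)) ℂ) *
        (fourierMat χ : Matrix (W →ₗ.[F] (ι → F)) (FamilySub F W ι) ℂ) =
      (fourierMat χ : Matrix (W →ₗ.[F] (ι → F)) (FamilySub F W ι) ℂ) *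
        (coverMat FamilyCovers : Matrix (FamilySub F W ι) (FamilySub F W ι) ℂ) := by
  ext p ⟨ψ, U, hψ⟩
  rw [Matrix.mul_apply, Matrix.mul_apply]
  trans if SubCovers U p.domain then χ (pmapPairing p ψ) else 0
  · by_cases hU : SubCovers U p.domain
    · rw [if_pos hU, Finset.sum_eq_single (p.domRestrict U)]
      · have hd := finrank_domRestrict hU.1
        have hc : PMapCovers (p.domRestrict U) p :=
          ⟨LinearPMap.domRestrict_le, by rw [hd]; exact hU.2⟩
        simp only [coverMat, fourierMat, if_pos hc, if_pos hd, one_mul]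
        rw [pmapPairing_eq_of_le hc.1]
        rw [hd]; exact hψ
      · intro p' _ hp'
        simp only [coverMat, fourierMat]
        split_ifs with h1 h2
        · exfalso
          apply hp'
          apply LinearPMap.ext (h2.trans (finrank_domRestrict hU.1).symm)
          intro x hx hx'
          have e1 : p' ⟨x, hx⟩ = p ⟨x, h1.1.1 hx⟩ := h1.1.2 rfl
          have e2 : p.domRestrict U ⟨x, hx'⟩ = p ⟨x, h1.1.1 hx⟩ :=
            LinearPMap.domRestrict_le.2 rfl
          rw [e1, e2]
        all_goals simp
      · simp
    · rw [if_neg hU]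
      refine Finset.sum_eq_zero fun p' _ => ?_
      simp only [coverMat, fourierMat]
      split_ifs with h1 h2
      · exfalso
        apply hU
        rw [← h2]
        exact ⟨h1.1.1, h1.2⟩
      all_goals simp
  · by_cases hU : SubCovers U p.domain
    · rw [if_pos hU, Finset.sum_eq_single ⟨ψ, p.domain, fun i => hU.1 (hψ i)⟩]
      · have : FamilyCovers (F := F) ⟨ψ, U, hψ⟩ ⟨ψ, p.domain, fun i => hU.1 (hψ i)⟩ := ⟨rfl, hU⟩
        simp [coverMat, fourierMat, this]
      · rintro ⟨ψ', U', hψ'⟩ _ hne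
        simp only [coverMat, fourierMat]
        split_ifs with h1 h2
        · obtain rfl : ψ = ψ' := h2.1
          obtain rfl : p.domain = U' := h1
          exact absurd rfl hne
        all_goals simp
      · simp
    · rw [if_neg hU]
      symm
      refine Finset.sum_eq_zero ?_
      rintro ⟨ψ', U', hψ'⟩ _
      simp only [coverMat, fourierMat]
      split_ifs with h1 h2
      · exfalso
        apply hU
        rw [h1]
        exact h2.2
      all_goals simp

/-- Linear maps defined on subspaces, sorted by their domain. -/
def pmapEquivSigma : (W →ₗ.[F] (ι → F)) ≃ Σ U : Submodule F W, (U →ₗ[F] (ι → F)) where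
  toFun p := ⟨p.domain, p.toFun⟩
  invFun x := ⟨x.1, x.2⟩
  left_inv _ := rfl
  right_inv _ := rfl

lemma sum_pmap_eq (U : Submodule F W) (f : (W →ₗ.[F] (ι → F)) → ℂ) :
    ∑ p, (if p.domain = U then f p else 0) = ∑ g : U →ₗ[F] (ι → F), f ⟨U, g⟩ := by
  rw [← Equiv.sum_comp pmapEquivSigma.symm, Fintype.sum_sigma, Finset.sum_eq_single U]
  · simp [pmapEquivSigma]
  · intro V _ hV
    simp [pmapEquivSigma, hV]
  · simp

lemma card_linearMap (U : Submodule F W) :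
    Fintype.card (U →ₗ[F] (ι → F)) = Fintype.card F ^ (Fintype.card ι * finrank F U) := by
  rw [Module.card_eq_pow_finrank (K := F), Module.finrank_linearMap, Module.finrank_pi, mul_comm]

lemma card_pmap_eq_card_familySub :
    Fintype.card (W →ₗ.[F] (ι → F)) = Fintype.card (FamilySub F W ι) := by
  let e : FamilySub F W ι ≃ Σ U : Submodule F W, (ι → U) :=
    { toFun := fun x => ⟨x.2.1, fun i => ⟨x.1 i, x.2.2 i⟩⟩
      invFun := fun x => ⟨fun i => x.2 i, x.1, fun i => (x.2 i).2⟩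
      left_inv := fun _ => rfl
      right_inv := fun _ => rfl }
  let _ : ∀ U : Submodule F W, Fintype U := fun U => Fintype.ofFinite U
  rw [Fintype.card_congr pmapEquivSigma, Fintype.card_congr e, Fintype.card_sigma,
    Fintype.card_sigma]
  refine Finset.sum_congr rfl fun U _ => ?_
  rw [card_linearMap, Fintype.card_fun, Module.card_eq_pow_finrank (K := F) (V := U), ← pow_mul,
    mul_comm]

lemma sum_char_linearMap {χ : AddChar F ℂ} (hχ : ∃ a, χ a ≠ 1) (U : Submodule F W) (v : ι → U) :
    ∑ g : U →ₗ[F] (ι → F), χ (∑ i, g (v i) i) =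
      if v = 0 then (Fintype.card F : ℂ) ^ (Fintype.card ι * finrank F U) else 0 := by
  let ev : (U →ₗ[F] (ι → F)) →+ F :=
    { toFun := fun g => ∑ i, g (v i) i
      map_zero' := by simp
      map_add' := fun g g' => by simp [Finset.sum_add_distrib] }
  have h := AddChar.sum_eq_ite (χ.compAddMonoidHom ev)
  have h0 : χ.compAddMonoidHom ev = 0 ↔ v = 0 := by
    constructor
    · intro h0
      by_contra hv
      obtain ⟨i, hi⟩ := Function.ne_iff.1 hv
      obtain ⟨f, hf⟩ := Module.Projective.exists_dual_eq_one F hi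
      obtain ⟨a, ha⟩ := hχ
      apply ha
      have := DFunLike.congr_fun h0 ((LinearMap.single F (fun _ : ι => F) i).comp (a • f))
      have e : ev ((LinearMap.single F (fun _ : ι => F) i).comp (a • f)) = a := by
        change ∑ j, ((LinearMap.single F (fun _ : ι => F) i).comp (a • f)) (v j) j = a
        rw [Finset.sum_eq_single i]
        · simp [hf]
        · intro j _ hj
          simp [hj]
        · simp
      rw [AddChar.compAddMonoidHom_apply, e] at this
      simpa using this
    · rintro rfl
      ext g
      simp [ev]
  rw [card_linearMap] at h
  simp only [h0] at h
  push_cast at h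
  exact h

lemma pmapPairing_mk (U : Submodule F W) (g : U →ₗ[F] (ι → F)) (ψ : ι → W) (hψ : ∀ i, ψ i ∈ U) :
    pmapPairing ⟨U, g⟩ ψ = ∑ i, g ⟨ψ i, hψ i⟩ i := by
  refine Finset.sum_congr rfl fun i _ => ?_
  rw [dif_pos (hψ i)]
  rfl

lemma fourierMat_orthogonality {χ : AddChar F ℂ} (hχ : ∃ a, χ a ≠ 1) :
    (fourierMat χ⁻¹ : Matrix (W →ₗ.[F] (ι → F)) (FamilySub F W ι) ℂ)ᵀ *
        (fourierMat χ : Matrix (W →ₗ.[F] (ι → F)) (FamilySub F W ι) ℂ) =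
      diagonal fun x => ((Fintype.card F : ℂ) ^ Fintype.card ι) ^ finrank F x.2.1 := by
  ext ⟨ψ, U, hψ⟩ ⟨ψ', U', hψ'⟩
  rw [Matrix.mul_apply, diagonal_apply]
  simp only [transpose_apply, fourierMat]
  by_cases hU : U = U'
  · subst hU
    have : ∀ p : W →ₗ.[F] (ι → F),
        ((if p.domain = U then χ⁻¹ (pmapPairing p ψ) else 0) *
          if p.domain = U then χ (pmapPairing p ψ') else 0) =
        if p.domain = U then χ (pmapPairing p ψ' - pmapPairing p ψ) else 0 := by
      intro p
      split_ifs
      · rw [sub_eq_neg_add, AddChar.map_add_eq_mul, AddChar.inv_apply]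
      · simp
    simp only [this]
    rw [sum_pmap_eq U fun p => χ (pmapPairing p ψ' - pmapPairing p ψ)]
    have h := sum_char_linearMap hχ U fun i => (⟨ψ' i, hψ' i⟩ - ⟨ψ i, hψ i⟩ : U)
    simp only [map_sub, Pi.sub_apply, Finset.sum_sub_distrib] at h
    simp only [pmapPairing_mk U _ ψ hψ, pmapPairing_mk U _ ψ' hψ']
    rw [h, pow_mul]
    refine if_congr ?_ rfl rfl
    constructor
    · intro h
      have : ψ = ψ' := by
        funext i
        have := congrFun h i
        simpa [sub_eq_zero] using (congrArg Subtype.val (sub_eq_zero.1 this)).symm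
      subst this; rfl
    · intro h
      have : ψ = ψ' := congrArg (fun x : FamilySub F W ι => x.1) h
      subst this
      funext i; simp
  · rw [if_neg (fun h => hU (congrArg (fun x : FamilySub F W ι => x.2.1) h))]
    refine Finset.sum_eq_zero fun p _ => ?_
    split_ifs with h1 h2
    · exact absurd (h1.symm.trans h2) hU
    all_goals simp

end PartialMaps

section Decomposition

set_option linter.unusedSectionVars false

variable {W : Type} [AddCommGroup W] [Module F W] [Finite W]
variable {ι : Type} [Fintype ι]

/-- The weighted adjacency matrix of the subspace lattice of `W`. -/
def subAdj (F W : Type) [Field F] [Fintype F] [AddCommGroup W] [Module F W] [Finite W]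
    (s t : ℂ) : Matrix (Submodule F W) (Submodule F W) ℂ :=
  wAdj SubCovers (fun U => finrank F U) (Fintype.card F) s fun _ => t

/-- The weighted adjacency matrix of the poset of linear maps defined on subspaces. -/
def pmapAdj (F W ι : Type) [Field F] [Fintype F] [AddCommGroup W] [Module F W] [Finite W]
    [Fintype ι] (s t : ℂ) : Matrix (W →ₗ.[F] (ι → F)) (W →ₗ.[F] (ι → F)) ℂ :=
  wAdj PMapCovers (fun p => finrank F p.domain) (Fintype.card F) s fun _ => t

/-- The weighted adjacency matrix on subspaces containing a family, with diagonal weight depending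
on the family. -/
def familyAdj (F : Type) {W ι : Type} [Field F] [Fintype F] [AddCommGroup W] [Module F W]
    [Finite W] [Fintype ι] (s : ℂ) (τ : (ι → W) → ℂ) :
    Matrix (FamilySub F W ι) (FamilySub F W ι) ℂ :=
  wAdj FamilyCovers (fun x => finrank F x.2.1) (Fintype.card F) s fun x => τ x.1

lemma exists_addChar_ne_one (F : Type) [Field F] [Fintype F] : ∃ χ : AddChar F ℂ, ∃ a, χ a ≠ 1 := by
  obtain ⟨χ, hχ⟩ := AddChar.exists_apply_ne_zero.2 (one_ne_zero (α := F))
  exact ⟨χ, 1, hχ⟩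

lemma card_field_ne_zero (F : Type) [Field F] [Fintype F] : (Fintype.card F : ℂ) ≠ 0 :=
  Nat.cast_ne_zero.2 Fintype.card_ne_zero

/-- The inverse of the Fourier matrix. -/
def fourierInv (χ : AddChar F ℂ) : Matrix (FamilySub F W ι) (W →ₗ.[F] (ι → F)) ℂ :=
  (diagonal fun x : FamilySub F W ι =>
      (((Fintype.card F : ℂ) ^ Fintype.card ι) ^ finrank F x.2.1)⁻¹) *
    (fourierMat χ⁻¹ : Matrix (W →ₗ.[F] (ι → F)) (FamilySub F W ι) ℂ)ᵀ

lemma fourierInv_mul {χ : AddChar F ℂ} (hχ : ∃ a, χ a ≠ 1) :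
    (fourierInv χ : Matrix (FamilySub F W ι) (W →ₗ.[F] (ι → F)) ℂ) *
      (fourierMat χ : Matrix (W →ₗ.[F] (ι → F)) (FamilySub F W ι) ℂ) = 1 := by
  rw [fourierInv, Matrix.mul_assoc, fourierMat_orthogonality hχ, diagonal_mul_diagonal,
    ← diagonal_one]
  congr 1
  funext x
  exact inv_mul_cancel₀ (pow_ne_zero _ (pow_ne_zero _ (card_field_ne_zero F)))

lemma mul_fourierInv {χ : AddChar F ℂ} (hχ : ∃ a, χ a ≠ 1) :
    (fourierMat χ : Matrix (W →ₗ.[F] (ι → F)) (FamilySub F W ι) ℂ) *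
      (fourierInv χ : Matrix (FamilySub F W ι) (W →ₗ.[F] (ι → F)) ℂ) = 1 :=
  (Matrix.mul_eq_one_comm_of_card_eq _ _ _ card_pmap_eq_card_familySub).2 (fourierInv_mul hχ)

lemma diagonal_mul_fourierMat (χ : AddChar F ℂ) (f : ℕ → ℂ) :
    (diagonal fun p : W →ₗ.[F] (ι → F) => f (finrank F p.domain)) *
        (fourierMat χ : Matrix (W →ₗ.[F] (ι → F)) (FamilySub F W ι) ℂ) =
      (fourierMat χ : Matrix (W →ₗ.[F] (ι → F)) (FamilySub F W ι) ℂ) *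
        diagonal fun x : FamilySub F W ι => f (finrank F x.2.1) := by
  ext p x
  rw [diagonal_mul, mul_diagonal, fourierMat]
  split_ifs with h
  · rw [h, mul_comm]
  · simp

lemma coverMat_transpose_mul_fourierMat {χ : AddChar F ℂ} (hχ : ∃ a, χ a ≠ 1) :
    (coverMat PMapCovers : Matrix (W →ₗ.[F] (ι → F)) (W →ₗ.[F] (ι → F)) ℂ)ᵀ *
        (fourierMat χ : Matrix (W →ₗ.[F] (ι → F)) (FamilySub F W ι) ℂ) =
      ((Fintype.card F : ℂ) ^ Fintype.card ι) •
      ((fourierMat χ : Matrix (W →ₗ.[F] (ι → F)) (FamilySub F W ι) ℂ) *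
        (coverMat FamilyCovers : Matrix (FamilySub F W ι) (FamilySub F W ι) ℂ)ᵀ) := by
  have h := congrArg transpose (coverMat_mul_fourierMat (W := W) (ι := ι) χ⁻¹)
  rw [transpose_mul, transpose_mul] at h
  have hinv : (fourierInv χ : Matrix (FamilySub F W ι) (W →ₗ.[F] (ι → F)) ℂ) *
      ((coverMat PMapCovers : Matrix (W →ₗ.[F] (ι → F)) (W →ₗ.[F] (ι → F)) ℂ)ᵀ *
        (fourierMat χ : Matrix (W →ₗ.[F] (ι → F)) (FamilySub F W ι) ℂ)) =
      ((Fintype.card F : ℂ) ^ Fintype.card ι) •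
        (coverMat FamilyCovers : Matrix (FamilySub F W ι) (FamilySub F W ι) ℂ)ᵀ := by
    rw [fourierInv, ← Matrix.mul_assoc, Matrix.mul_assoc (diagonal _), h, Matrix.mul_assoc,
      Matrix.mul_assoc, fourierMat_orthogonality hχ]
    ext x y
    rw [diagonal_mul, mul_diagonal, Matrix.smul_apply, transpose_apply, coverMat]
    split_ifs with hc
    · have hq := card_field_ne_zero F
      rw [hc.2.2, pow_succ]
      field_simp
      simp
    · simp
  rw [← Matrix.mul_smul, ← hinv, ← Matrix.mul_assoc, mul_fourierInv hχ, Matrix.one_mul]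

lemma pmapAdj_mul_fourierMat {χ : AddChar F ℂ} (hχ : ∃ a, χ a ≠ 1) (s t : ℂ) :
    pmapAdj F W ι s t * (fourierMat χ : Matrix (W →ₗ.[F] (ι → F)) (FamilySub F W ι) ℂ) =
      (fourierMat χ : Matrix (W →ₗ.[F] (ι → F)) (FamilySub F W ι) ℂ) *
        (familyAdj F (s * (Fintype.card F : ℂ) ^ Fintype.card ι) (fun _ => t) :
          Matrix (FamilySub F W ι) (FamilySub F W ι) ℂ) := by
  rw [pmapAdj, familyAdj, wAdj, wAdj, Matrix.add_mul, Matrix.add_mul, Matrix.mul_add,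
    Matrix.mul_add, coverMat_mul_fourierMat, Matrix.mul_assoc,
    coverMat_transpose_mul_fourierMat hχ, Matrix.mul_smul, ← Matrix.mul_assoc,
    diagonal_mul_fourierMat χ fun n => s * (Fintype.card F : ℂ) ^ n,
    diagonal_mul_fourierMat χ fun n => t * (Fintype.card F : ℂ) ^ n, Matrix.mul_assoc,
    ← Matrix.mul_smul, ← Matrix.smul_mul, ← diagonal_smul]
  congr 4
  congr 1
  funext x
  simp only [Pi.smul_apply, smul_eq_mul]
  ring

lemma eigMult_pmapAdj (s t θ : ℂ) :
    eigMult (pmapAdj F W ι s t) θ =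
      eigMult (familyAdj F (W := W) (ι := ι) (s * (Fintype.card F : ℂ) ^ Fintype.card ι)
        fun _ => t) θ := by
  obtain ⟨χ, hχ⟩ := exists_addChar_ne_one F
  exact eigMult_eq_of_intertwine _ _ (mul_fourierInv hχ) (fourierInv_mul hχ)
    (pmapAdj_mul_fourierMat hχ s t) θ

instance instFiniteQuotient (K : Submodule F W) : Finite (W ⧸ K) :=
  Finite.of_surjective K.mkQ K.mkQ_surjective

lemma finrank_comap_mkQ (K : Submodule F W) (V : Submodule F (W ⧸ K)) :
    finrank F (V.comap K.mkQ) = finrank F V + finrank F K := by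
  have h := (K.mkQ.domRestrict (V.comap K.mkQ)).finrank_range_add_finrank_ker
  have hr : LinearMap.range (K.mkQ.domRestrict (V.comap K.mkQ)) = V := by
    rw [LinearMap.range_domRestrict, Submodule.map_comap_eq_of_surjective K.mkQ_surjective]
  have hle : K ≤ V.comap K.mkQ := by
    intro x hx
    rw [Submodule.mem_comap, Submodule.mkQ_apply, (Submodule.Quotient.mk_eq_zero K).2 hx]
    exact V.zero_mem
  have hk : finrank F (LinearMap.ker (K.mkQ.domRestrict (V.comap K.mkQ))) = finrank F K := by
    rw [LinearMap.ker_domRestrict, Submodule.ker_mkQ]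
    exact (Submodule.comapSubtypeEquivOfLe hle).finrank_eq
  rw [hr, hk] at h
  exact h.symm

/-- Subspaces containing the family `ψ` correspond to subspaces of the quotient by its span. -/
def quotientEquivContaining (ψ : ι → W) :
    Submodule F (W ⧸ Submodule.span F (Set.range ψ)) ≃ {U : Submodule F W // ∀ i, ψ i ∈ U} :=
  (Submodule.comapMkQRelIso (Submodule.span F (Set.range ψ))).toEquiv.trans
    (Equiv.subtypeEquivRight fun U => by
      rw [Set.mem_Ici, Submodule.span_le, Set.range_subset_iff]; rfl)

lemma eigMult_familyAdj [Fintype (ι → W)] (s : ℂ) (τ : (ι → W) → ℂ) (θ : ℂ) :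
    eigMult (familyAdj F s τ) θ =
      ∑ ψ : ι → W, eigMult (subAdj F (W ⧸ Submodule.span F (Set.range ψ))
        (s * (Fintype.card F : ℂ) ^ finrank F (Submodule.span F (Set.range ψ)))
        (τ ψ * (Fintype.card F : ℂ) ^ finrank F (Submodule.span F (Set.range ψ)))) θ := by
  have hblock : familyAdj F s τ = blockDiagonal' fun ψ : ι → W =>
      wAdj (fun U V : {U : Submodule F W // ∀ i, ψ i ∈ U} => SubCovers U.1 V.1)
        (fun U => finrank F U.1) (Fintype.card F) s fun _ => τ ψ := by
    ext ⟨ψ, U⟩ ⟨ψ', U'⟩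
    by_cases h : ψ = ψ'
    · subst h
      rw [blockDiagonal'_apply_eq, familyAdj, wAdj_apply, wAdj_apply]
      simp [FamilyCovers]
    · rw [blockDiagonal'_apply_ne _ _ _ h, familyAdj, wAdj_apply]
      simp [FamilyCovers, h, Ne.symm h]
  rw [hblock]
  convert eigMult_blockDiagonal' _ θ with ψ
  rw [subAdj]
  refine (eigMult_wAdj_congr (quotientEquivContaining ψ) _ ?_ ?_ _ _ _ θ).symm
  · intro V V'
    have h1 := finrank_comap_mkQ (Submodule.span F (Set.range ψ)) V
    have h2 := finrank_comap_mkQ (Submodule.span F (Set.range ψ)) V'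
    have h3 : V.comap (Submodule.span F (Set.range ψ)).mkQ ≤
        V'.comap (Submodule.span F (Set.range ψ)).mkQ ↔ V ≤ V' :=
      Submodule.comap_le_comap_iff_of_surjective (Submodule.mkQ_surjective _)
    change SubCovers V V' ↔ SubCovers (V.comap (Submodule.span F (Set.range ψ)).mkQ)
      (V'.comap (Submodule.span F (Set.range ψ)).mkQ)
    rw [SubCovers, SubCovers, h1, h2, h3]
    exact and_congr_right fun _ => by omega
  · intro V
    exact finrank_comap_mkQ _ V

end Decomposition

section LineExtension

set_option linter.unusedSectionVars false

variable {W : Type} [AddCommGroup W] [Module F W] [Finite W]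
variable {ι : Type} [Fintype ι]

lemma finrank_graph (p : W →ₗ.[F] (ι → F)) : finrank F p.graph = finrank F p.domain := by
  let g : p.domain →ₗ[F] W × (ι → F) := p.domain.subtype.prod p.toFun
  have hg : Function.Injective g := fun x y h => Subtype.ext (congrArg Prod.fst h)
  have hr : LinearMap.range g = p.graph := by
    ext x
    rw [LinearPMap.mem_graph_iff']
    rfl
  rw [← hr, LinearMap.finrank_range_of_inj hg]

lemma graph_fst_eq_zero {p : W →ₗ.[F] (ι → F)} {x : W × (ι → F)} (hx : x ∈ p.graph)
    (h : x.1 = 0) : x.2 = 0 :=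
  p.graph_fst_eq_zero_snd hx h

/-- The subspaces of `W × F` are the graphs of functionals on subspaces of `W`
and the preimages of the subspaces of `W`. -/
def lineExtensionEquiv :
    (W →ₗ.[F] (Unit → F)) ⊕ Submodule F W ≃ Submodule F (W × (Unit → F)) :=
  Equiv.ofBijective (Sum.elim LinearPMap.graph fun U => U.prod ⊤) (by
    have hne : ∀ (p : W →ₗ.[F] (Unit → F)) (U : Submodule F W), p.graph ≠ U.prod ⊤ := by
      intro p U h
      have h1 : ((0 : W), (1 : Unit → F)) ∈ p.graph := by
        rw [h]; exact ⟨U.zero_mem, trivial⟩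
      exact one_ne_zero (graph_fst_eq_zero h1 rfl)
    constructor
    · rintro (p | U) (p' | U') h
      · exact congrArg Sum.inl (LinearPMap.eq_of_eq_graph h)
      · exact absurd h (hne p U')
      · exact absurd h.symm (hne p' U)
      · refine congrArg Sum.inr ?_
        ext x
        have := SetLike.ext_iff.1 h (x, 0)
        simpa using this
    · intro y
      by_cases hy : ∀ x ∈ y, x.1 = 0 → x.2 = 0
      · exact ⟨Sum.inl y.toLinearPMap, y.toLinearPMap_graph_eq fun x hx => hy x hx⟩
      · push Not at hy
        obtain ⟨⟨x, c⟩, hx, rfl, hc⟩ := hy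
        have hc' : c () ≠ 0 := fun h => hc (funext fun _ => h)
        have hall : ∀ d : Unit → F, ((0 : W), d) ∈ y := by
          intro d
          have := y.smul_mem (d () / c ()) hx
          have e : (d () / c ()) • ((0 : W), c) = (0, d) := by
            ext i
            · simp
            · simp [hc']
          rwa [e] at this
        refine ⟨Sum.inr (y.map (LinearMap.fst F W (Unit → F))), ?_⟩
        ext ⟨w, d⟩
        simp only [Sum.elim_inr, Submodule.mem_prod, Submodule.mem_map, LinearMap.fst_apply,
          Submodule.mem_top, and_true]
        constructor
        · rintro ⟨⟨w', d'⟩, h, rfl⟩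
          have := y.add_mem h (hall (d - d'))
          simpa using this
        · intro h
          exact ⟨_, h, rfl⟩)

lemma finrank_prod_top (U : Submodule F W) :
    finrank F (U.prod (⊤ : Submodule F (Unit → F))) = finrank F U + 1 := by
  have hinj : Function.Injective
      (U.subtype.prodMap (LinearMap.id : (Unit → F) →ₗ[F] (Unit → F))) :=
    U.injective_subtype.prodMap Function.injective_id
  have h := LinearMap.finrank_range_of_inj hinj
  rw [LinearMap.range_prodMap, Submodule.range_subtype, LinearMap.range_id, Module.finrank_prod]
    at h
  simpa using h

/-- The zero family together with a subspace. -/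
def zeroFamily (U : Submodule F W) : FamilySub F W ι := ⟨0, U, fun _ => U.zero_mem⟩

/-- The incidence matrix between partially defined maps and their domains. -/
def domainMat : Matrix (W →ₗ.[F] (ι → F)) (Submodule F W) ℂ :=
  fun p U => if p.domain = U then 1 else 0

/-- The inclusion of functions on subspaces as functions supported on the zero family. -/
def zeroFamilyMat : Matrix (FamilySub F W ι) (Submodule F W) ℂ :=
  fun x U => if x = zeroFamily U then 1 else 0

@[simp] lemma zeroFamily_fst (U : Submodule F W) :
    (zeroFamily U : FamilySub F W ι).1 = 0 := rfl

@[simp] lemma zeroFamily_snd (U : Submodule F W) :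
    (zeroFamily U : FamilySub F W ι).2.1 = U := rfl

lemma eq_zeroFamily_iff (x : FamilySub F W ι) (U : Submodule F W) :
    x = zeroFamily U ↔ x.1 = 0 ∧ x.2.1 = U := by
  obtain ⟨ψ, V, hV⟩ := x
  constructor
  · intro h
    rw [h]
    exact ⟨rfl, rfl⟩
  · rintro ⟨h1, h2⟩
    dsimp only at h1 h2
    subst h1 h2
    rfl

lemma zeroFamily_injective :
    Function.Injective (zeroFamily : Submodule F W → FamilySub F W ι) := by
  intro U V h
  exact ((eq_zeroFamily_iff _ _).1 h).2

lemma zeroFamilyMat_transpose_mul_self :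
    (zeroFamilyMat : Matrix (FamilySub F W ι) (Submodule F W) ℂ)ᵀ *
      (zeroFamilyMat : Matrix (FamilySub F W ι) (Submodule F W) ℂ) = 1 := by
  ext U V
  rw [Matrix.mul_apply, Finset.sum_eq_single (zeroFamily U)]
  · simp [zeroFamilyMat, zeroFamily_injective.eq_iff, Matrix.one_apply]
  · intro x _ hx
    simp [zeroFamilyMat, hx]
  · simp

lemma mul_zeroFamilyMat_apply {P : Type} (A : Matrix P (FamilySub F W ι) ℂ) (y : P)
    (U : Submodule F W) :
    (A * (zeroFamilyMat : Matrix (FamilySub F W ι) (Submodule F W) ℂ)) y U =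
      A y (zeroFamily U) := by
  rw [Matrix.mul_apply, Finset.sum_eq_single (zeroFamily U)]
  · simp [zeroFamilyMat]
  · intro x _ hx
    simp [zeroFamilyMat, hx]
  · simp

lemma zeroFamilyMat_transpose_mul_apply {P : Type} (A : Matrix (FamilySub F W ι) P ℂ) (y : P)
    (U : Submodule F W) :
    ((zeroFamilyMat : Matrix (FamilySub F W ι) (Submodule F W) ℂ)ᵀ * A) U y =
      A (zeroFamily U) y := by
  rw [← transpose_apply (_ * A), transpose_mul, transpose_transpose, mul_zeroFamilyMat_apply,
    transpose_apply]

lemma zeroFamilyMat_mul_apply {P : Type} (A : Matrix (Submodule F W) P ℂ) (x : FamilySub F W ι)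
    (y : P) :
    ((zeroFamilyMat : Matrix (FamilySub F W ι) (Submodule F W) ℂ) * A) x y =
      if x.1 = 0 then A x.2.1 y else 0 := by
  rw [Matrix.mul_apply, Finset.sum_eq_single x.2.1]
  · simp [zeroFamilyMat, eq_zeroFamily_iff]
  · intro U _ hU
    simp [zeroFamilyMat, eq_zeroFamily_iff, hU.symm]
  · simp

lemma familyAdj_mul_zeroFamilyMat (s : ℂ) (τ : (ι → W) → ℂ) :
    familyAdj F s τ * (zeroFamilyMat : Matrix (FamilySub F W ι) (Submodule F W) ℂ) =
      (zeroFamilyMat : Matrix (FamilySub F W ι) (Submodule F W) ℂ) * subAdj F W s (τ 0) := by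
  ext x U
  rw [mul_zeroFamilyMat_apply, zeroFamilyMat_mul_apply, familyAdj, subAdj, wAdj_apply, wAdj_apply]
  have hx : x = zeroFamily U ↔ x.1 = 0 ∧ x.2.1 = U := eq_zeroFamily_iff x U
  by_cases h : x.1 = 0
  · simp only [FamilyCovers, zeroFamily_fst, zeroFamily_snd, hx, h, true_and,
      if_true]
  · simp only [FamilyCovers, zeroFamily_fst, zeroFamily_snd, hx, h, Ne.symm h, false_and,
      if_false, add_zero]

lemma zeroFamilyMat_transpose_mul_familyAdj (s : ℂ) (τ : (ι → W) → ℂ) :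
    (zeroFamilyMat : Matrix (FamilySub F W ι) (Submodule F W) ℂ)ᵀ * familyAdj F s τ =
      subAdj F W s (τ 0) * (zeroFamilyMat : Matrix (FamilySub F W ι) (Submodule F W) ℂ)ᵀ := by
  ext U x
  rw [zeroFamilyMat_transpose_mul_apply, ← transpose_apply (_ * _), transpose_mul,
    transpose_transpose, zeroFamilyMat_mul_apply, transpose_apply, familyAdj, subAdj, wAdj_apply,
    wAdj_apply]
  have hx : zeroFamily U = x ↔ x.1 = 0 ∧ U = x.2.1 := by
    rw [eq_comm, eq_zeroFamily_iff, eq_comm (a := U)]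
  by_cases h : x.1 = 0
  · simp only [FamilyCovers, zeroFamily_fst, zeroFamily_snd, hx, h, true_and,
      if_true]
    rfl
  · simp only [FamilyCovers, zeroFamily_fst, zeroFamily_snd, hx, h, Ne.symm h, false_and,
      if_false, add_zero]

/-- The diagonal matrix of `q ^ dim U`. -/
def dimMat (F W : Type) [Field F] [Fintype F] [AddCommGroup W] [Module F W] [Finite W] :
    Matrix (Submodule F W) (Submodule F W) ℂ :=
  diagonal fun U => (Fintype.card F : ℂ) ^ finrank F U

lemma domainMat_eq (χ : AddChar F ℂ) :
    (domainMat : Matrix (W →ₗ.[F] (ι → F)) (Submodule F W) ℂ) =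
      (fourierMat χ : Matrix (W →ₗ.[F] (ι → F)) (FamilySub F W ι) ℂ) *
        (zeroFamilyMat : Matrix (FamilySub F W ι) (Submodule F W) ℂ) := by
  ext p U
  rw [mul_zeroFamilyMat_apply, fourierMat, domainMat]
  simp only [zeroFamily]
  refine if_congr Iff.rfl ?_ rfl
  have h : pmapPairing p 0 = 0 :=
    Finset.sum_eq_zero fun i _ => by
      rw [dif_pos (show (0 : ι → W) i ∈ p.domain from p.domain.zero_mem)]
      exact congrFun p.map_zero i
  rw [h, AddChar.map_zero_eq_one]

lemma domainMat_transpose_mul_fourierMat {χ : AddChar F ℂ} (hχ : ∃ a, χ a ≠ 1) :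
    (domainMat : Matrix (W →ₗ.[F] (Unit → F)) (Submodule F W) ℂ)ᵀ *
      (fourierMat χ : Matrix (W →ₗ.[F] (Unit → F)) (FamilySub F W Unit) ℂ) =
    dimMat F W * (zeroFamilyMat : Matrix (FamilySub F W Unit) (Submodule F W) ℂ)ᵀ := by
  rw [domainMat_eq χ⁻¹, transpose_mul, Matrix.mul_assoc, fourierMat_orthogonality hχ, dimMat]
  ext U x
  rw [mul_diagonal, diagonal_mul, transpose_apply, zeroFamilyMat]
  split_ifs with h
  · subst h
    simp only [one_mul, mul_one, Fintype.card_unit, pow_one]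
    rfl
  · simp

lemma familyAdj_update (s t α : ℂ) :
    (familyAdj F s (fun _ => t) : Matrix (FamilySub F W ι) (FamilySub F W ι) ℂ) +
      α • ((zeroFamilyMat : Matrix (FamilySub F W ι) (Submodule F W) ℂ) *
        (dimMat F W * (zeroFamilyMat : Matrix (FamilySub F W ι) (Submodule F W) ℂ)ᵀ)) =
    familyAdj F s fun ψ => if ψ = 0 then t + α else t := by
  ext x y
  rw [Matrix.add_apply, Matrix.smul_apply, zeroFamilyMat_mul_apply, dimMat, diagonal_mul,
    transpose_apply, zeroFamilyMat, familyAdj, familyAdj, wAdj_apply, wAdj_apply, add_assoc]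
  congr 1
  by_cases h : x.1 = 0
  · have hy : y = zeroFamily x.2.1 ↔ x = y := by
      rw [← (eq_zeroFamily_iff x x.2.1).2 ⟨h, rfl⟩, eq_comm]
    simp only [h, if_true, hy]
    split_ifs
    · simp; ring
    · simp
  · simp [h]

lemma eigMult_fromBlocks_of_isometry {P P' : Type} [Fintype P] [Fintype P']
    [DecidableEq P] [DecidableEq P'] {A : Matrix P P ℂ} {Z : Matrix P P' ℂ}
    {D T : Matrix P' P' ℂ} (hZ : Zᵀ * Z = 1) (h₁ : A * Z = Z * T) (h₂ : Zᵀ * A = T * Zᵀ)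
    {α β : ℂ} (hαβ : α + β ≠ 0) (θ : ℂ) :
    eigMult (fromBlocks A ((α * β) • (Z * D)) (D * Zᵀ) (T + (α - β) • D)) θ =
      eigMult (A + α • (Z * (D * Zᵀ))) θ + eigMult (T - β • D) θ := by
  rw [← eigMult_fromBlocks]
  symm
  let S : Matrix (P ⊕ P') (P ⊕ P') ℂ := fromBlocks 1 (α • Z) Zᵀ (-β • 1)
  let S' : Matrix (P ⊕ P') (P ⊕ P') ℂ :=
    fromBlocks (1 - ((α + β)⁻¹ * α) • (Z * Zᵀ)) (((α + β)⁻¹ * α) • Z) ((α + β)⁻¹ • Zᵀ)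
      (-(α + β)⁻¹ • 1)
  have hSS' : S * S' = 1 := by
    rw [fromBlocks_multiply, ← fromBlocks_one]
    congr 1
    · simp [smul_smul, mul_comm]
    · simp [smul_smul, mul_comm]
    · simp only [Matrix.mul_sub, Matrix.mul_smul, Matrix.mul_one, ← Matrix.mul_assoc, hZ,
        Matrix.one_mul, Matrix.smul_mul, smul_smul]
      rw [← one_smul ℂ Zᵀ, smul_smul, smul_smul, ← sub_smul, ← add_smul]
      convert zero_smul ℂ _ using 2
      field_simp
      ring
    · simp only [Matrix.mul_smul, hZ, Matrix.mul_one, smul_smul]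
      rw [← add_smul]
      convert one_smul ℂ _ using 2
      field_simp
  refine eigMult_eq_of_intertwine S S' hSS' (mul_eq_one_comm.1 hSS') ?_ θ
  rw [fromBlocks_multiply, fromBlocks_multiply]
  congr 1
  · simp
  · simp only [Matrix.add_mul, Matrix.mul_add, Matrix.mul_smul, Matrix.smul_mul, Matrix.one_mul,
      Matrix.mul_one, h₁, Matrix.mul_assoc, hZ, smul_smul, smul_zero, add_zero]
    module
  · simp only [Matrix.sub_mul, Matrix.mul_one, Matrix.smul_mul, Matrix.one_mul, h₂,
      zero_add]
    module
  · simp only [Matrix.mul_one, Matrix.smul_mul, Matrix.one_mul, Matrix.mul_smul,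
      ← Matrix.mul_assoc, hZ, Matrix.zero_mul]
    module

end LineExtension

section LineRecursion

set_option linter.unusedSectionVars false

variable {W : Type} [AddCommGroup W] [Module F W] [Finite W]

lemma subAdj_add_smul_dimMat (s t c : ℂ) :
    subAdj F W s t + c • dimMat F W = subAdj F W s (t + c) := by
  ext U V
  rw [Matrix.add_apply, Matrix.smul_apply, subAdj, subAdj, dimMat, wAdj_apply, wAdj_apply,
    add_assoc, diagonal_apply]
  congr 1
  split_ifs
  · rw [smul_eq_mul, add_mul]
  · simp

lemma not_prod_top_le_graph (U : Submodule F W) (p : W →ₗ.[F] (Unit → F)) :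
    ¬ U.prod ⊤ ≤ p.graph := by
  intro h
  have h1 : ((0 : W), (1 : Unit → F)) ∈ p.graph := h ⟨U.zero_mem, trivial⟩
  exact one_ne_zero (graph_fst_eq_zero h1 rfl)

lemma graph_le_prod_top_iff (p : W →ₗ.[F] (Unit → F)) (U : Submodule F W) :
    p.graph ≤ U.prod ⊤ ↔ p.domain ≤ U := by
  constructor
  · intro h x hx
    exact (h (p.mem_graph ⟨x, hx⟩)).1
  · rintro h ⟨x, c⟩ hx
    exact ⟨h (LinearPMap.mem_domain_of_mem_graph hx), trivial⟩

lemma prod_top_le_prod_top_iff (U V : Submodule F W) :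
    U.prod (⊤ : Submodule F (Unit → F)) ≤ V.prod ⊤ ↔ U ≤ V := by
  constructor
  · intro h x hx
    exact (h (show (x, (0 : Unit → F)) ∈ U.prod ⊤ from ⟨hx, trivial⟩)).1
  · intro h x hx
    exact ⟨h hx.1, trivial⟩

lemma subCovers_graph_graph (p p' : W →ₗ.[F] (Unit → F)) :
    SubCovers p.graph p'.graph ↔ PMapCovers p p' := by
  rw [SubCovers, PMapCovers, finrank_graph, finrank_graph, LinearPMap.le_graph_iff]

lemma subCovers_graph_prod_top (p : W →ₗ.[F] (Unit → F)) (U : Submodule F W) :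
    SubCovers p.graph (U.prod ⊤) ↔ p.domain = U := by
  rw [SubCovers, finrank_graph, finrank_prod_top, graph_le_prod_top_iff]
  constructor
  · rintro ⟨h1, h2⟩
    exact Submodule.eq_of_le_of_finrank_eq h1 (by omega)
  · rintro rfl
    exact ⟨le_rfl, rfl⟩

lemma subCovers_prod_top_prod_top (U V : Submodule F W) :
    SubCovers (U.prod (⊤ : Submodule F (Unit → F))) (V.prod ⊤) ↔ SubCovers U V := by
  rw [SubCovers, SubCovers, finrank_prod_top, finrank_prod_top, prod_top_le_prod_top_iff,
    Nat.add_right_cancel_iff]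

lemma subAdj_submatrix_lineExtensionEquiv (s t : ℂ) :
    (subAdj F (W × (Unit → F)) s t).submatrix lineExtensionEquiv lineExtensionEquiv =
      fromBlocks (pmapAdj F W Unit s t)
        (s • ((domainMat : Matrix (W →ₗ.[F] (Unit → F)) (Submodule F W) ℂ) * dimMat F W))
        (domainMat : Matrix (W →ₗ.[F] (Unit → F)) (Submodule F W) ℂ)ᵀ
        (subAdj F W (s * Fintype.card F) (t * Fintype.card F)) := by
  have hl (p : W →ₗ.[F] (Unit → F)) : lineExtensionEquiv (Sum.inl p) = p.graph := rfl
  have hr (U : Submodule F W) : lineExtensionEquiv (Sum.inr U) = U.prod ⊤ := rfl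
  have hn (U : Submodule F W) (p : W →ₗ.[F] (Unit → F)) : ¬ SubCovers (U.prod ⊤) p.graph :=
    fun h => not_prod_top_le_graph U p h.1
  have hne (p : W →ₗ.[F] (Unit → F)) (U : Submodule F W) : p.graph ≠ U.prod ⊤ :=
    fun h => not_prod_top_le_graph U p h.ge
  ext (p | U) (p' | U')
  · rw [submatrix_apply, fromBlocks_apply₁₁, hl, hl, subAdj, pmapAdj, wAdj_apply, wAdj_apply]
    have heq : p.graph = p'.graph ↔ p = p' := ⟨LinearPMap.eq_of_eq_graph, congrArg _⟩
    simp only [subCovers_graph_graph, finrank_graph, heq]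
  · rw [submatrix_apply, fromBlocks_apply₁₂, hl, hr, subAdj, wAdj_apply, Matrix.smul_apply,
      dimMat, mul_diagonal, domainMat]
    simp only [subCovers_graph_prod_top, finrank_graph, hn, hne, if_false, zero_add, add_zero]
    split_ifs with h
    · subst h
      simp
    · simp
  · rw [submatrix_apply, fromBlocks_apply₂₁, hl, hr, subAdj, wAdj_apply, transpose_apply,
      domainMat]
    simp only [subCovers_graph_prod_top, hn, (hne _ _).symm, if_false, add_zero]
  · rw [submatrix_apply, fromBlocks_apply₂₂, hr, hr, subAdj, subAdj, wAdj_apply, wAdj_apply]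
    have heq : U.prod (⊤ : Submodule F (Unit → F)) = U'.prod ⊤ ↔ U = U' := by
      simp only [le_antisymm_iff, prod_top_le_prod_top_iff]
    simp only [subCovers_prod_top_prod_top, finrank_prod_top, heq, pow_succ]
    congr 2
    · congr 1; ring
    · ring

lemma card_field_sub_one_ne_zero (F : Type) [Field F] [Fintype F] :
    (Fintype.card F : ℂ) - 1 ≠ 0 := by
  rw [sub_ne_zero]
  exact_mod_cast (Fintype.one_lt_card (α := F)).ne'

lemma eigMult_subAdj_prod {α β : ℂ} (hαβ : α + β ≠ 0) (θ : ℂ) :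
    eigMult (subAdj F (W × (Unit → F)) (α * β) ((α - β) / (Fintype.card F - 1))) θ =
      eigMult (familyAdj F (W := W) (ι := Unit) (α * β * Fintype.card F) fun ψ =>
        if ψ = 0 then (α - β) / (Fintype.card F - 1) + α else (α - β) / (Fintype.card F - 1)) θ +
      eigMult (subAdj F W (α * β * Fintype.card F) ((α - β) / (Fintype.card F - 1) - β)) θ := by
  obtain ⟨χ, hχ⟩ := exists_addChar_ne_one F
  set t : ℂ := (α - β) / (Fintype.card F - 1) with ht
  have htq : t * Fintype.card F = t + (α - β) := by
    have := card_field_sub_one_ne_zero F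
    rw [ht]
    field_simp
    ring
  have hT := familyAdj_mul_zeroFamilyMat (F := F) (W := W) (ι := Unit)
    (α * β * Fintype.card F) fun _ => t
  have hT' := zeroFamilyMat_transpose_mul_familyAdj (F := F) (W := W) (ι := Unit)
    (α * β * Fintype.card F) fun _ => t
  have key := eigMult_fromBlocks_of_isometry (D := dimMat F W) zeroFamilyMat_transpose_mul_self
    hT hT' hαβ θ
  rw [familyAdj_update, sub_eq_add_neg (subAdj F W _ t), ← neg_smul, subAdj_add_smul_dimMat,
    subAdj_add_smul_dimMat] at key
  rw [sub_eq_add_neg t β, ← key, ← eigMult_submatrix _ lineExtensionEquiv,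
    subAdj_submatrix_lineExtensionEquiv, htq]
  let S : Matrix ((W →ₗ.[F] (Unit → F)) ⊕ Submodule F W)
      (FamilySub F W Unit ⊕ Submodule F W) ℂ := fromBlocks (fourierMat χ) 0 0 1
  let S' : Matrix (FamilySub F W Unit ⊕ Submodule F W)
      ((W →ₗ.[F] (Unit → F)) ⊕ Submodule F W) ℂ := fromBlocks (fourierInv χ) 0 0 1
  refine eigMult_eq_of_intertwine S S' ?_ ?_ ?_ θ
  · simp only [S, S', fromBlocks_multiply, mul_fourierInv hχ]
    simp
  · simp only [S, S', fromBlocks_multiply, fourierInv_mul hχ]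
    simp
  · have h1 := pmapAdj_mul_fourierMat (W := W) (ι := Unit) hχ (α * β) t
    rw [Fintype.card_unit, pow_one] at h1
    simp only [S, fromBlocks_multiply, Matrix.mul_zero, Matrix.zero_mul, Matrix.mul_one,
      Matrix.one_mul, smul_zero, add_zero, zero_add, h1, domainMat_transpose_mul_fourierMat hχ,
      Matrix.mul_smul]
    rw [domainMat_eq χ, Matrix.mul_assoc]

end LineRecursion

section GaussianRecursion

/-- The Gaussian binomial coefficients, defined by the Pascal recursion. -/
def gaussRec (q : ℕ) : ℕ → ℕ → ℕ
  | _, 0 => 1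
  | 0, _ + 1 => 0
  | n + 1, j + 1 => gaussRec q n j + q ^ (j + 1) * gaussRec q n (j + 1)

@[simp] lemma gaussRec_zero_right (q n : ℕ) : gaussRec q n 0 = 1 := by
  cases n <;> rfl

lemma gaussRec_succ_succ (q n j : ℕ) :
    gaussRec q (n + 1) (j + 1) = gaussRec q n j + q ^ (j + 1) * gaussRec q n (j + 1) := rfl

lemma gaussRec_eq_zero_of_lt (q : ℕ) {n j : ℕ} (h : n < j) : gaussRec q n j = 0 := by
  induction n generalizing j with
  | zero => cases j with
    | zero => omega
    | succ j => rfl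
  | succ n ih => cases j with
    | zero => omega
    | succ j => rw [gaussRec_succ_succ, ih (by omega), ih (by omega), mul_zero, add_zero]

lemma gaussRec_self (q n : ℕ) : gaussRec q n n = 1 := by
  induction n with
  | zero => rfl
  | succ n ih =>
    rw [gaussRec_succ_succ, ih, gaussRec_eq_zero_of_lt q (Nat.lt_succ_self n), mul_zero, add_zero]

lemma gaussRec_absorption (q n j : ℕ) :
    ((q : ℤ) ^ (j + 1) - 1) * gaussRec q (n + 1) (j + 1) = (q ^ (n + 1) - 1) * gaussRec q n j := by
  induction n generalizing j with
  | zero => cases j with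
    | zero => simp [gaussRec_succ_succ, gaussRec_eq_zero_of_lt]
    | succ j => simp [gaussRec_eq_zero_of_lt]
  | succ n ih => cases j with
    | zero =>
      have h := ih 0
      rw [gaussRec_succ_succ]
      push_cast
      simp only [gaussRec_zero_right, Nat.cast_one] at *
      linear_combination (q : ℤ) ^ (0 + 1) * h
    | succ j =>
      have h1 := ih j
      have h2 := ih (j + 1)
      rw [gaussRec_succ_succ q (n + 1) (j + 1)]
      have h3 : (gaussRec q (n + 1) (j + 1) : ℤ) =
          gaussRec q n j + q ^ (j + 1) * gaussRec q n (j + 1) := by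
        rw [gaussRec_succ_succ]; push_cast; ring
      push_cast
      linear_combination (q : ℤ) ^ (j + 2) * h2 + q * h1 - q * (q ^ (n + 1) - 1) * h3

lemma sum_gaussRec_succ {q : ℕ} (n : ℕ) (f : ℕ → ℕ) (hq : 0 < q) :
    ∑ j ∈ range (n + 2), gaussRec q (n + 1) j * f j =
      ∑ j ∈ range (n + 1), gaussRec q n j * f j +
      (q ^ n - 1) * ∑ j ∈ range n, gaussRec q (n - 1) j * f (j + 1) +
      ∑ j ∈ range (n + 1), gaussRec q n j * f (j + 1) := by
  have hpow : ∀ m, 1 ≤ q ^ m := fun m => Nat.one_le_pow _ _ hq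
  rw [sum_range_succ', sum_range_succ' (fun j => gaussRec q n j * f j),
    sum_range_succ (fun j => gaussRec q (n + 1) (j + 1) * f (j + 1)),
    sum_range_succ (fun j => gaussRec q n j * f (j + 1)), mul_sum, gaussRec_self, gaussRec_self]
  have h : ∀ j ∈ range n, gaussRec q (n + 1) (j + 1) * f (j + 1) =
      gaussRec q n (j + 1) * f (j + 1) + (q ^ n - 1) * (gaussRec q (n - 1) j * f (j + 1)) +
        gaussRec q n j * f (j + 1) := by
    intro j hj
    obtain ⟨m, rfl⟩ : ∃ m, n = m + 1 := ⟨n - 1, by have := mem_range.1 hj; omega⟩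
    have h1 := gaussRec_absorption q m j
    zify [hpow]
    rw [gaussRec_succ_succ q (m + 1) j]
    push_cast
    linear_combination (f (j + 1) : ℤ) * h1
  rw [sum_congr rfl h, sum_add_distrib, sum_add_distrib]
  simp only [gaussRec_zero_right]
  ring

end GaussianRecursion

section LatticeSpectrum

set_option linter.unusedSectionVars false

/-- The eigenvalues of the weighted adjacency matrix of the subspace lattice. -/
def latticeEig (q : ℕ) (α β : ℝ) (n j : ℕ) : ℂ :=
  ((α * (q : ℝ) ^ (n - j) - β * (q : ℝ) ^ j) / ((q : ℝ) - 1) : ℝ)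

/-- The multiplicity of `θ` as an eigenvalue of the weighted adjacency matrix of the subspace
lattice of an `n`-dimensional space. -/
def latticeMult (q : ℕ) (α β : ℝ) (n : ℕ) (θ : ℂ) : ℕ :=
  ∑ j ∈ range (n + 1), gaussRec q n j * if θ = latticeEig q α β n j then 1 else 0

lemma latticeMult_succ {q : ℕ} (hq : 0 < q) (α β : ℝ) (n : ℕ) (θ : ℂ) :
    latticeMult q α β (n + 1) θ =
      latticeMult q (α * q) β n θ + (q ^ n - 1) * latticeMult q (α * q) (β * q) (n - 1) θ +
        latticeMult q α (β * q) n θ := by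
  rw [latticeMult, sum_gaussRec_succ _ _ hq]
  congr 1
  · congr 1
    · refine sum_congr rfl fun j hj => ?_
      have hj' : n + 1 - j = n - j + 1 := by have := mem_range.1 hj; omega
      rw [latticeEig, latticeEig, hj', pow_succ, mul_assoc, mul_comm (q : ℝ)]
    · cases n with
      | zero => simp
      | succ n =>
        congr 1
        refine sum_congr rfl fun j hj => ?_
        have hj' : n + 1 + 1 - (j + 1) = n - j + 1 := by have := mem_range.1 hj; omega
        rw [latticeEig, latticeEig, hj', pow_succ, pow_succ, mul_assoc, mul_comm (q : ℝ),
          mul_assoc, mul_comm (q : ℝ), Nat.add_sub_cancel]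
  · refine sum_congr rfl fun j hj => ?_
    rw [latticeEig, latticeEig, Nat.add_sub_add_right, pow_succ, mul_assoc β, mul_comm (q : ℝ)]

variable {W W' : Type} [AddCommGroup W] [Module F W] [Finite W]
  [AddCommGroup W'] [Module F W'] [Finite W']

lemma eigMult_subAdj_congr (e : W ≃ₗ[F] W') (s t θ : ℂ) :
    eigMult (subAdj F W s t) θ = eigMult (subAdj F W' s t) θ := by
  have h := eigMult_wAdj_congr (c := SubCovers (F := F) (W := W'))
    (d := fun U => finrank F U) (c' := SubCovers (F := F) (W := W))
    (d' := fun U => finrank F U) (Submodule.orderIsoMapComap e).toEquiv 0 ?_ ?_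
    (Fintype.card F) s t θ
  · rw [pow_zero, mul_one, mul_one] at h
    exact h.symm
  · intro U V
    have hd : ∀ U : Submodule F W,
        finrank F ((Submodule.orderIsoMapComap e).toEquiv U) = finrank F U :=
      fun U => LinearEquiv.finrank_map_eq e U
    rw [SubCovers, SubCovers, hd, hd]
    exact and_congr_left fun _ => (Submodule.orderIsoMapComap e).le_iff_le.symm
  · intro U
    exact LinearEquiv.finrank_map_eq e U

lemma eigMult_subAdj_of_subsingleton (hW : finrank F W = 0) (s t θ : ℂ) :
    eigMult (subAdj F W s t) θ = if θ = t then 1 else 0 := by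
  have hsub : Subsingleton W := finrank_zero_iff.1 hW
  have hmat : ∀ v : Submodule F W → ℂ, subAdj F W s t *ᵥ v = t • v := by
    intro v
    have : subAdj F W s t = diagonal fun _ => t := by
      ext U V
      obtain rfl := Subsingleton.elim U V
      rw [subAdj, wAdj_apply]
      have hU : finrank F U = 0 := finrank_zero_of_subsingleton
      simp [SubCovers, hU]
    rw [this]
    ext U
    simp [mulVec_diagonal]
  rw [eigMult]
  split_ifs with h
  · have htop : Module.End.eigenspace (subAdj F W s t).mulVecLin θ = ⊤ := by
      rw [eq_top_iff]
      intro v _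
      rw [mem_eigenspace_mulVecLin, hmat, h]
    rw [htop, finrank_top, Module.finrank_pi, Fintype.card_eq_one_iff]
    exact ⟨⊥, fun U => Subsingleton.elim _ _⟩
  · have hbot : Module.End.eigenspace (subAdj F W s t).mulVecLin θ = ⊥ := by
      rw [eq_bot_iff]
      intro v hv
      rw [mem_eigenspace_mulVecLin, hmat, ← sub_eq_zero, ← sub_smul, smul_eq_zero] at hv
      exact hv.resolve_left (sub_ne_zero.2 (Ne.symm h))
    rw [hbot, finrank_bot]

theorem eigMult_subAdj (n : ℕ) (hn : finrank F W = n) {α β : ℝ} (hα : 0 < α) (hβ : 0 < β)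
    (θ : ℂ) :
    eigMult (subAdj F W ((α : ℂ) * β) (((α : ℂ) - β) / (Fintype.card F - 1))) θ =
      latticeMult (Fintype.card F) α β n θ := by
  induction n using Nat.strong_induction_on generalizing W α β with
  | _ n ih =>
  have hq : (0 : ℝ) < Fintype.card F := Nat.cast_pos.2 Fintype.card_pos
  have hq1 := card_field_sub_one_ne_zero F
  cases n with
  | zero =>
    rw [eigMult_subAdj_of_subsingleton hn, latticeMult]
    simp [latticeEig]
  | succ n =>
    have e : W ≃ₗ[F] (Fin n → F) × (Unit → F) := LinearEquiv.ofFinrankEq _ _ (by simp [hn])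
    have hαβ : (α : ℂ) + β ≠ 0 := by exact_mod_cast (add_pos hα hβ).ne'
    rw [eigMult_subAdj_congr e, eigMult_subAdj_prod hαβ, latticeMult_succ Fintype.card_pos]
    congr 1
    · rw [eigMult_familyAdj, ← Finset.add_sum_erase _ _ (Finset.mem_univ (0 : Unit → Fin n → F))]
      congr 1
      · have h0 : finrank F (Submodule.span F (Set.range (0 : Unit → Fin n → F))) = 0 := by
          rw [Set.range_unique, Pi.zero_apply, Submodule.span_zero_singleton, finrank_bot]
        have h1 := Submodule.finrank_quotient_add_finrank
          (Submodule.span F (Set.range (0 : Unit → Fin n → F)))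
        rw [h0, Module.finrank_fin_fun] at h1
        rw [← ih n (Nat.lt_succ_self n) h1 (mul_pos hα hq) hβ, h0, if_pos rfl]
        congr 2
        · push_cast; ring
        · push_cast; field_simp; ring
      · rw [Finset.sum_congr rfl (g := fun _ => latticeMult (Fintype.card F)
          (α * Fintype.card F) (β * Fintype.card F) (n - 1) θ)]
        · rw [Finset.sum_const, Finset.card_erase_of_mem (Finset.mem_univ _), Finset.card_univ,
            smul_eq_mul]
          congr 2
          simp
        · intro ψ hψ
          have hψ0 : ψ ≠ 0 := Finset.ne_of_mem_erase hψ
          have h0 : finrank F (Submodule.span F (Set.range ψ)) = 1 := by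
            rw [Set.range_unique]
            exact finrank_span_singleton fun h => hψ0 (funext fun _ => h)
          have h1 := Submodule.finrank_quotient_add_finrank (Submodule.span F (Set.range ψ))
          rw [h0, Module.finrank_fin_fun] at h1
          rw [← ih (n - 1) (by omega) (Nat.eq_sub_of_add_eq h1) (mul_pos hα hq) (mul_pos hβ hq), h0,
            if_neg hψ0]
          congr 2
          · push_cast; ring
          · push_cast; field_simp
    · rw [← ih n (Nat.lt_succ_self n) (Module.finrank_fin_fun F) hα (mul_pos hβ hq)]
      congr 2
      · push_cast; ring
      · push_cast; field_simp; ring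

end LatticeSpectrum

section AttenuatedSpace

set_option linter.unusedSectionVars false

variable {W : Type} [AddCommGroup W] [Module F W] [Finite W]

lemma exists_equiv_prod_of_finrank {h : Submodule F H} {N M : ℕ} (hH : finrank F H = N + M)
    (hh : finrank F h = M) :
    ∃ e : ((Fin N → F) × (Fin M → F)) ≃ₗ[F] H, ∀ x, e x ∈ h ↔ x.1 = 0 := by
  obtain ⟨W, hW⟩ := h.exists_isCompl
  have hsum := Submodule.finrank_add_eq_of_isCompl hW
  let f : (Fin M → F) ≃ₗ[F] h := LinearEquiv.ofFinrankEq _ _ (by simp [hh])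
  have hWN : finrank F W = N := by omega
  let g : (Fin N → F) ≃ₗ[F] W := LinearEquiv.ofFinrankEq _ _ (by simp [hWN])
  refine ⟨(g.prodCongr f).trans (Submodule.prodEquivOfIsCompl W h hW.symm), fun x => ?_⟩
  have := Submodule.prodEquivOfIsCompl_symm_apply_fst_eq_zero (p := W) (q := h) hW.symm
    (x := Submodule.prodEquivOfIsCompl W h hW.symm (g.prodCongr f x))
  rw [LinearEquiv.symm_apply_apply] at this
  rw [← g.map_eq_zero_iff]
  exact this.symm

/-- The vertices of the attenuated space are the graphs of linear maps defined on subspaces of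
a complement. -/
def attEquiv {h : Submodule F H} {M : ℕ} (e : (W × (Fin M → F)) ≃ₗ[F] H)
    (he : ∀ x, e x ∈ h ↔ x.1 = 0) : (W →ₗ.[F] (Fin M → F)) ≃ AttX h :=
  Equiv.ofBijective
    (fun p => ⟨p.graph.map (e : (W × (Fin M → F)) →ₗ[F] H), by
      rw [eq_bot_iff]
      rintro _ ⟨⟨x, hx, rfl⟩, hxh⟩
      have h1 : x.1 = 0 := (he x).1 hxh
      have h2 : x = 0 := Prod.ext h1 (p.graph_fst_eq_zero_snd hx h1)
      rw [h2]
      exact e.map_zero⟩)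
    (by
      constructor
      · intro p p' hp
        exact LinearPMap.eq_of_eq_graph
          (Submodule.map_injective_of_injective e.injective (congrArg Subtype.val hp))
      · rintro ⟨y, hy⟩
        have hg : (y.comap (e : (W × (Fin M → F)) →ₗ[F] H)).toLinearPMap.graph =
            y.comap (e : (W × (Fin M → F)) →ₗ[F] H) := by
          refine Submodule.toLinearPMap_graph_eq _ fun x hx hx1 => ?_
          have hbot : e x ∈ y ⊓ h := ⟨hx, (he x).2 hx1⟩
          rw [hy, Submodule.mem_bot, LinearEquiv.map_eq_zero_iff] at hbot
          rw [hbot]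
          rfl
        refine ⟨(y.comap (e : (W × (Fin M → F)) →ₗ[F] H)).toLinearPMap, Subtype.ext ?_⟩
        exact (congrArg _ hg).trans (Submodule.map_comap_eq_of_surjective e.surjective y))

lemma finrank_attEquiv {h : Submodule F H} {M : ℕ} (e : (W × (Fin M → F)) ≃ₗ[F] H)
    (he : ∀ x, e x ∈ h ↔ x.1 = 0) (p : W →ₗ.[F] (Fin M → F)) :
    vdim h (attEquiv e he p) = finrank F p.domain := by
  rw [← finrank_graph p]
  exact LinearEquiv.finrank_map_eq e p.graph

lemma attCovers_attEquiv {h : Submodule F H} {M : ℕ} (e : (W × (Fin M → F)) ≃ₗ[F] H)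
    (he : ∀ x, e x ∈ h ↔ x.1 = 0) (p p' : W →ₗ.[F] (Fin M → F)) :
    PMapCovers p p' ↔ AttCovers h (attEquiv e he p) (attEquiv e he p') := by
  rw [PMapCovers, AttCovers, finrank_attEquiv, finrank_attEquiv]
  refine and_congr_left fun _ => ?_
  change _ ↔ p.graph.map _ ≤ p'.graph.map _
  rw [Submodule.map_le_map_iff_of_injective e.injective, LinearPMap.le_graph_iff]

lemma Amat_eq_wAdj (h : Submodule F H) (q : ℕ) :
    Amat h q = wAdj (AttCovers h) (vdim h) q 1 fun _ => 0 := by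
  ext y z
  rw [wAdj_apply, Amat]
  by_cases h1 : AttCovers h z y
  · have h2 : ¬ AttCovers h y z := fun h2 => by
      have := h1.2
      have := h2.2
      omega
    simp [h1, h2]
  · simp [h1]

lemma finrank_eigA (h : Submodule F H) {q N M k : ℕ} (hq : Fintype.card F = q)
    (hH : finrank F H = N + M) (hh : finrank F h = M) :
    finrank ℂ (eigA h q N M k) = ∑ ψ : Fin M → Fin N → F, latticeMult q
        (Real.sqrt q ^ (M + finrank F (Submodule.span F (Set.range ψ))))
        (Real.sqrt q ^ (M + finrank F (Submodule.span F (Set.range ψ))))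
        (N - finrank F (Submodule.span F (Set.range ψ))) (theta q N M k) := by
  obtain ⟨e, he⟩ := exists_equiv_prod_of_finrank hH hh
  have hpos : 0 < Real.sqrt q :=
    Real.sqrt_pos.2 (Nat.cast_pos.2 (hq ▸ Fintype.card_pos))
  have h1 : finrank ℂ (eigA h q N M k) = eigMult (Amat h q) (theta q N M k) := by
    rw [eigA, eigMult]
    congr
  rw [h1, Amat_eq_wAdj, eigMult_wAdj_congr (d' := fun p => finrank F p.domain) (attEquiv e he) 0
    (attCovers_attEquiv e he) (finrank_attEquiv e he), pow_zero, mul_one, mul_one]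
  have h2 := eigMult_pmapAdj (F := F) (W := Fin N → F) (ι := Fin M) 1 0 (theta q N M k : ℂ)
  rw [pmapAdj, hq] at h2
  rw [h2, eigMult_familyAdj]
  refine sum_congr rfl fun ψ _ => ?_
  have h3 := Submodule.finrank_quotient_add_finrank (Submodule.span F (Set.range ψ))
  rw [Module.finrank_fin_fun] at h3
  subst hq
  rw [← eigMult_subAdj (F := F) _ (Nat.eq_sub_of_add_eq h3) (pow_pos hpos _) (pow_pos hpos _)]
  congr 2
  · rw [← Complex.ofReal_mul, ← mul_pow, Real.mul_self_sqrt (Nat.cast_nonneg _)]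
    push_cast
    rw [Fintype.card_fin]
    ring
  · simp

end AttenuatedSpace

section FamilyCount

set_option linter.unusedSectionVars false

lemma finrank_span_cons {W : Type} [AddCommGroup W] [Module F W] [Finite W] {M : ℕ} (w : W)
    (ψ : Fin M → W) :
    finrank F (Submodule.span F (Set.range (Fin.cons w ψ : Fin (M + 1) → W))) =
      if w ∈ Submodule.span F (Set.range ψ) then finrank F (Submodule.span F (Set.range ψ))
      else finrank F (Submodule.span F (Set.range ψ)) + 1 := by
  rw [Fin.range_cons]
  split_ifs with h
  · rw [Submodule.span_insert_eq_span h]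
  · rw [Submodule.span_insert, sup_comm]
    have hw : w ≠ 0 := fun h0 => h (h0 ▸ Submodule.zero_mem _)
    have hinf : Submodule.span F (Set.range ψ) ⊓ Submodule.span F {w} = ⊥ :=
      ((Submodule.disjoint_span_singleton' hw).2 h).eq_bot
    have hsum := Submodule.finrank_sup_add_finrank_inf_eq (Submodule.span F (Set.range ψ))
      (Submodule.span F {w})
    rw [hinf, finrank_bot, finrank_span_singleton hw] at hsum
    exact hsum

lemma sum_finrank_span_cons {N M : ℕ} (ψ : Fin M → Fin N → F) (f : ℕ → ℕ) :
    ∑ w : Fin N → F,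
        f (finrank F (Submodule.span F (Set.range (Fin.cons w ψ : Fin (M + 1) → Fin N → F)))) =
      Fintype.card F ^ finrank F (Submodule.span F (Set.range ψ)) *
          f (finrank F (Submodule.span F (Set.range ψ))) +
        (Fintype.card F ^ N - Fintype.card F ^ finrank F (Submodule.span F (Set.range ψ))) *
          f (finrank F (Submodule.span F (Set.range ψ)) + 1) := by
  have hcard : (univ.filter fun w : Fin N → F => w ∈ Submodule.span F (Set.range ψ)).card =
      Fintype.card F ^ finrank F (Submodule.span F (Set.range ψ)) := by
    rw [← Module.card_eq_pow_finrank (K := F) (V := Submodule.span F (Set.range ψ)),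
      Fintype.card_subtype]
  have hcompl : (univ.filter fun w : Fin N → F => ¬ w ∈ Submodule.span F (Set.range ψ)).card =
      Fintype.card F ^ N - Fintype.card F ^ finrank F (Submodule.span F (Set.range ψ)) := by
    rw [← hcard, Finset.filter_not, Finset.card_sdiff_of_subset (Finset.filter_subset _ _),
      Finset.card_univ, Fintype.card_fun, Fintype.card_fin]
  simp only [finrank_span_cons, apply_ite f]
  rw [Finset.sum_ite, Finset.sum_const, Finset.sum_const, hcard, hcompl, smul_eq_mul, smul_eq_mul]

lemma sum_finrank_span {N : ℕ} (M : ℕ) (f : ℕ → ℕ) :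
    ∑ ψ : Fin M → Fin N → F, f (finrank F (Submodule.span F (Set.range ψ))) =
      ∑ r ∈ range (N + 1), gaussRec (Fintype.card F) M r *
        (∏ i ∈ range r, (Fintype.card F ^ N - Fintype.card F ^ i)) * f r := by
  induction M generalizing f with
  | zero =>
    rw [sum_range_succ']
    have hbot : ∀ ψ : Fin 0 → Fin N → F, finrank F (Submodule.span F (Set.range ψ)) = 0 :=
      fun ψ => by rw [Set.range_eq_empty, Submodule.span_empty, finrank_bot]
    simp [gaussRec, hbot]
  | succ M ih =>
    rw [← (Fin.consEquiv fun _ : Fin (M + 1) => Fin N → F).sum_comp, Fintype.sum_prod_type_right]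
    change ∑ ψ : Fin M → Fin N → F, ∑ w : Fin N → F, f (finrank F (Submodule.span F
      (Set.range (Fin.cons w ψ : Fin (M + 1) → Fin N → F)))) = _
    simp only [sum_finrank_span_cons]
    rw [ih fun r => Fintype.card F ^ r * f r + (Fintype.card F ^ N - Fintype.card F ^ r) *
      f (r + 1)]
    simp only [mul_add, sum_add_distrib]
    rw [sum_range_succ', sum_range_succ _ N, Nat.sub_self, sum_range_succ' _ N]
    simp only [gaussRec_succ_succ, prod_range_succ, gaussRec_zero_right, add_mul, sum_add_distrib]
    have h1 : ∀ r, gaussRec (Fintype.card F) M r *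
        (∏ i ∈ range r, (Fintype.card F ^ N - Fintype.card F ^ i)) *
        ((Fintype.card F ^ N - Fintype.card F ^ r) * f (r + 1)) =
        gaussRec (Fintype.card F) M r *
        ((∏ i ∈ range r, (Fintype.card F ^ N - Fintype.card F ^ i)) *
        (Fintype.card F ^ N - Fintype.card F ^ r)) * f (r + 1) := fun r => by ring
    simp only [h1, zero_mul, mul_zero, add_zero, pow_zero, one_mul]
    rw [add_comm, ← add_assoc]
    congr 2
    refine sum_congr rfl fun r _ => ?_
    ring

end FamilyCount

section Binomials

lemma gaussRec_absorption_nat {q : ℕ} (hq : 0 < q) (n j : ℕ) :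
    (q ^ (j + 1) - 1) * gaussRec q (n + 1) (j + 1) = (q ^ (n + 1) - 1) * gaussRec q n j := by
  have hpow : ∀ m, 1 ≤ q ^ m := fun m => Nat.one_le_pow _ _ hq
  zify [hpow]
  exact gaussRec_absorption q n j

lemma prod_pow_sub_pow_succ (q n r : ℕ) :
    ∏ i ∈ range (r + 1), (q ^ (n + 1) - q ^ i) =
      (q ^ (n + 1) - 1) * (q ^ r * ∏ i ∈ range r, (q ^ n - q ^ i)) := by
  rw [prod_range_succ', pow_zero, mul_comm]
  congr 1
  have h : ∀ i, q ^ (n + 1) - q ^ (i + 1) = q * (q ^ n - q ^ i) := fun i => by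
    rw [Nat.mul_sub, pow_succ', pow_succ']
  simp only [h]
  rw [prod_mul_distrib, prod_const, card_range]

lemma prod_pow_sub_pow_eq {q : ℕ} (hq : 0 < q) (n r : ℕ) :
    ∏ i ∈ range r, (q ^ n - q ^ i) = gaussRec q n r * ∏ i ∈ range r, (q ^ r - q ^ i) := by
  induction r generalizing n with
  | zero => simp
  | succ r ih => cases n with
    | zero =>
      rw [gaussRec_eq_zero_of_lt q (Nat.succ_pos r), zero_mul]
      exact prod_eq_zero (mem_range.2 (Nat.succ_pos r)) (by simp)
    | succ n =>
      rw [prod_pow_sub_pow_succ, prod_pow_sub_pow_succ, ih]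
      have := gaussRec_absorption_nat hq n r
      calc _ = (q ^ (n + 1) - 1) * gaussRec q n r *
              (q ^ r * ∏ i ∈ range r, (q ^ r - q ^ i)) := by ring
        _ = _ := by rw [← this]; ring

lemma qInt_mul {q : ℕ} (n : ℕ) : qInt q n * (q - 1) = q ^ n - 1 :=
  Nat.div_mul_cancel (by simpa using Nat.sub_dvd_pow_sub_pow q 1 n)

lemma qInt_pos {q n : ℕ} (hq : 1 < q) (hn : 0 < n) : 0 < qInt q n := by
  have h := qInt_mul (q := q) n
  have h1 : 1 < q ^ n := Nat.one_lt_pow hn.ne' hq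
  refine Nat.pos_of_ne_zero fun h0 => ?_
  rw [h0, zero_mul] at h
  omega

lemma one_lt_qInt {q n : ℕ} (hq : 1 < q) (hn : 1 < n) : 1 < qInt q n := by
  have h := qInt_mul (q := q) n
  have h1 : q < q ^ n := by simpa using Nat.pow_lt_pow_right hq hn
  by_contra h0
  have h2 : qInt q n * (q - 1) ≤ 1 * (q - 1) := Nat.mul_le_mul_right _ (by omega)
  rw [one_mul] at h2
  omega

lemma qFact_pos {q : ℕ} (hq : 1 < q) (n : ℕ) : 0 < qFact q n := by
  induction n with
  | zero => exact Nat.one_pos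
  | succ n ih => exact Nat.mul_pos (qInt_pos hq n.succ_pos) ih

lemma gaussRec_mul_qFact {q : ℕ} (hq : 1 < q) (m i : ℕ) :
    gaussRec q (m + i) i * (qFact q i * qFact q m) = qFact q (m + i) := by
  induction i with
  | zero => simp [qFact]
  | succ i ih =>
    have h : gaussRec q (m + i + 1) (i + 1) * qInt q (i + 1) =
        qInt q (m + i + 1) * gaussRec q (m + i) i := by
      refine Nat.eq_of_mul_eq_mul_right (Nat.sub_pos_of_lt hq) ?_
      rw [mul_assoc, qInt_mul, mul_right_comm, qInt_mul, mul_comm]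
      exact gaussRec_absorption_nat (by omega) _ _
    rw [← add_assoc, qFact, qFact]
    calc _ = gaussRec q (m + i + 1) (i + 1) * qInt q (i + 1) * (qFact q i * qFact q m) := by ring
      _ = _ := by rw [h, mul_assoc, ih]

lemma qBinom_eq_gaussRec {q n i : ℕ} (hq : 1 < q) (hi : i ≤ n) :
    qBinom q n i = gaussRec q n i := by
  have h := gaussRec_mul_qFact hq (n - i) i
  rw [Nat.sub_add_cancel hi] at h
  rw [qBinom, ← h, Nat.mul_div_cancel _ (Nat.mul_pos (qFact_pos hq _) (qFact_pos hq _))]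

lemma qFact_lt_qFact {q n i : ℕ} (hq : 1 < q) (hn : 0 < n) (hi : n < i) :
    qFact q n < qFact q i := by
  induction i, hi using Nat.le_induction with
  | base =>
    rw [qFact]
    exact lt_mul_of_one_lt_left (qFact_pos hq n) (one_lt_qInt hq (by omega))
  | succ i hi ih =>
    refine ih.trans_le ?_
    rw [qFact]
    exact Nat.le_mul_of_pos_left _ (qInt_pos hq i.succ_pos)

lemma qBinom_eq_gaussRec_of_pos {q n : ℕ} (hq : 1 < q) (hn : 0 < n) (i : ℕ) :
    qBinom q n i = gaussRec q n i := by
  rcases le_or_gt i n with hi | hi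
  · exact qBinom_eq_gaussRec hq hi
  · rw [gaussRec_eq_zero_of_lt q hi, qBinom]
    refine Nat.div_eq_of_lt ?_
    exact (qFact_lt_qFact hq hn hi).trans_le (Nat.le_mul_of_pos_right _ (qFact_pos hq _))

lemma muMult_eq {q N M r : ℕ} (hq : 1 < q) (hM : 0 < M) (hr : r ≤ N) :
    muMult q N M r = gaussRec q M r * ∏ i ∈ range r, (q ^ N - q ^ i) := by
  rw [muMult, qBinom_eq_gaussRec hq hr, qBinom_eq_gaussRec_of_pos hq hM,
    prod_pow_sub_pow_eq (by omega) N]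
  ring

end Binomials

section Spectrum

lemma latticeEig_eq_theta {q N M r j : ℕ} (hj : j + r ≤ N) :
    latticeEig q (Real.sqrt q ^ (M + r)) (Real.sqrt q ^ (M + r)) (N - r) j =
      (theta q N M (r + 2 * j) : ℝ) := by
  rw [latticeEig, theta]
  congr 1
  have hq : (q : ℝ) = Real.sqrt q ^ 2 := (Real.sq_sqrt (Nat.cast_nonneg q)).symm
  have h1 : Real.sqrt q ^ (M + r) * (q : ℝ) ^ (N - r - j) =
      Real.sqrt q ^ M * Real.sqrt q ^ (2 * N - (r + 2 * j)) := by
    nth_rewrite 2 [hq]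
    rw [← pow_mul, ← pow_add, ← pow_add]
    congr 1
    omega
  have h2 : Real.sqrt q ^ (M + r) * (q : ℝ) ^ j =
      Real.sqrt q ^ M * Real.sqrt q ^ (r + 2 * j) := by
    nth_rewrite 2 [hq]
    rw [← pow_mul, ← pow_add, ← pow_add, add_assoc]
  rw [h1, h2]
  ring

lemma theta_strictAnti {q : ℕ} (hq : 1 < q) (N M : ℕ) {a b : ℕ} (hab : a < b) :
    theta q N M b < theta q N M a := by
  have hs : 1 < Real.sqrt q := by
    rw [Real.lt_sqrt zero_le_one]
    simpa using hq
  have hq' : (0 : ℝ) < q - 1 := sub_pos.2 (by exact_mod_cast hq)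
  have h1 : Real.sqrt q ^ (2 * N - b) ≤ Real.sqrt q ^ (2 * N - a) :=
    pow_le_pow_right₀ hs.le (by omega)
  have h2 : Real.sqrt q ^ a < Real.sqrt q ^ b := pow_lt_pow_right₀ hs hab
  have h3 : 0 < Real.sqrt q ^ M := pow_pos (by linarith) M
  unfold theta
  exact mul_lt_mul_of_pos_right (div_lt_div_of_pos_right (by linarith) hq') h3

lemma theta_injective {q : ℕ} (hq : 1 < q) (N M : ℕ) : Function.Injective (theta q N M) :=
  StrictAnti.injective fun _ _ h => theta_strictAnti hq N M h

lemma latticeMult_theta {q N M r k : ℕ} (hq : 1 < q) (hr : r ≤ N) :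
    latticeMult q (Real.sqrt q ^ (M + r)) (Real.sqrt q ^ (M + r)) (N - r) (theta q N M k) =
      ∑ j ∈ range (N - r + 1), if k = r + 2 * j then gaussRec q (N - r) j else 0 := by
  rw [latticeMult]
  refine sum_congr rfl fun j hj => ?_
  have hj' := mem_range.1 hj
  have hiff : (theta q N M k : ℂ) = (theta q N M (r + 2 * j) : ℝ) ↔ k = r + 2 * j := by
    rw [Complex.ofReal_inj, (theta_injective hq N M).eq_iff]
  rw [latticeEig_eq_theta (by omega)]
  simp only [hiff, mul_ite, mul_one, mul_zero]

lemma sum_odd_decomposition {N k : ℕ} (hk : 2 * k + 1 ≤ N) (T : ℕ → ℕ → ℕ) :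
    ∑ r ∈ range (N + 1), ∑ j ∈ range (N - r + 1), (if 2 * k + 1 = r + 2 * j then T r j else 0) =
      ∑ l ∈ range (k + 1), T (2 * l + 1) (k - l) := by
  rw [sum_sigma', ← sum_filter]
  refine sum_nbij' (fun x => k - x.2) (fun l => ⟨2 * l + 1, k - l⟩) ?_ ?_ ?_ ?_ ?_
  · rintro ⟨r, j⟩ h
    simp only [mem_filter, mem_sigma, mem_range] at h ⊢
    omega
  · intro l h
    simp only [mem_filter, mem_sigma, mem_range] at h ⊢
    omega
  · rintro ⟨r, j⟩ h
    simp only [mem_filter, mem_sigma, mem_range] at h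
    have hj : k - (k - j) = j := by omega
    have hr : 2 * (k - j) + 1 = r := by omega
    dsimp only
    rw [hj, hr]
  · intro l h
    simp only [mem_range] at h ⊢
    omega
  · rintro ⟨r, j⟩ h
    simp only [mem_filter, mem_sigma, mem_range] at h ⊢
    congr 1 <;> omega

end Spectrum

/-- for a half-integer `i = k + 1/2 ∈ [N]` (not an integer) with `i ≤ N/2`
(encoded by the index `2k+1`), the eigenspace of `A` for `θ_i` has dimension
`∑_{ℓ=0}^{k} μ_(2ℓ+1) binom(N-2ℓ-1, k-ℓ)_q`. -/
theorem stmt15 (q N M : ℕ) (hq : Fintype.card F = q) (hN : 0 < N) (hM : 0 < M)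
    (h : Submodule F H) (hH : finrank F H = N + M) (hh : finrank F h = M)
    (k : ℕ) (hk : 2 * k + 1 ≤ N) :
    finrank ℂ (eigA h q N M (2 * k + 1))
      = ∑ l ∈ Finset.range (k + 1),
          muMult q N M (2 * l + 1) * qBinom q (N - 2 * l - 1) (k - l) := by
  have hq1 : 1 < q := hq ▸ Fintype.one_lt_card
  rw [finrank_eigA h hq hH hh]
  subst hq
  rw [sum_finrank_span M fun r => latticeMult (Fintype.card F)
    (Real.sqrt (Fintype.card F) ^ (M + r)) (Real.sqrt (Fintype.card F) ^ (M + r)) (N - r)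
    (theta (Fintype.card F) N M (2 * k + 1))]
  refine Eq.trans ?_ (sum_odd_decomposition hk fun r j => muMult (Fintype.card F) N M r *
    qBinom (Fintype.card F) (N - r) j)
  refine sum_congr rfl fun r hr => ?_
  have hr' : r ≤ N := by have := mem_range.1 hr; omega
  rw [latticeMult_theta hq1 hr', mul_sum, ← muMult_eq hq1 hM hr']
  refine sum_congr rfl fun j hj => ?_
  rw [qBinom_eq_gaussRec hq1 (by have := mem_range.1 hj; omega), mul_ite, mul_zero]
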